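/- arXiv:1702.01058 — 7 statements merged into one kernel-verified Lean document; each statement's English description precedes it below -/
import Mathlib

section
/- Every finite caterpillar admits a 2-coloring that is 3⁺-free, i.e., a coloring with 2 colors in which no factor contains a repetition of exponent strictly greater than 3. -/
open SimpleGraph

/-- The word `w` contains a repetition (period `p`, excess `e`) of exponent at least `β`:
`p ++ e` is a contiguous factor of `w`, `p` is nonempty, `e` is a prefix of `p ++ e`,
and the exponent `(|p| + |e|)/|p|` is at least `β`. -/
def HasRepGE {α : Type*} (β : ℝ) (w : List α) : Prop :=
  ∃ p e : List α, p ≠ [] ∧ (p ++ e) <:+: w ∧ e <+: (p ++ e) ∧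
    β ≤ ((p.length : ℝ) + (e.length : ℝ)) / (p.length : ℝ)

/-- The word `w` contains a repetition of exponent strictly greater than `β`. -/
def HasRepGT {α : Type*} (β : ℝ) (w : List α) : Prop :=
  ∃ p e : List α, p ≠ [] ∧ (p ++ e) <:+: w ∧ e <+: (p ++ e) ∧
    β < ((p.length : ℝ) + (e.length : ℝ)) / (p.length : ℝ)

/-- The coloring `c` of the graph `G` is `β⁺`-free: no factor (word read along the vertices of
a non-self-intersecting path) contains a repetition of exponent strictly greater than `β`. -/
def ColoringFreePlus {V α : Type*} (G : SimpleGraph V) (c : V → α) (β : ℝ) : Prop :=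
  ∀ (u v : V) (p : G.Walk u v), p.IsPath → ¬ HasRepGT β (p.support.map c)

/-- Some factor of the colored graph `(G, c)` is a repetition of exponent at least `β`. -/
def ColoringHasRepGE {V α : Type*} (G : SimpleGraph V) (c : V → α) (β : ℝ) : Prop :=
  ∃ (u v : V) (p : G.Walk u v), p.IsPath ∧ HasRepGE β (p.support.map c)

/-- A caterpillar: a (finite) tree in which the vertices of degree at least 2 induce a path.
Since the graph is acyclic, the induced subgraph on `{v | 2 ≤ degree v}` is a path exactly
when these vertices can be listed without repetition so that consecutive ones are adjacent. -/
def IsCaterpillar {V : Type*} [Fintype V] (G : SimpleGraph V) [DecidableRel G.Adj] : Prop :=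
  G.IsTree ∧ ∃ l : List V, l.Nodup ∧ (∀ v : V, v ∈ l ↔ 2 ≤ G.degree v) ∧ l.Chain' G.Adj

/-- Thue–Morse sequence. -/
def tm (n : ℕ) : Bool :=
  if h : n = 0 then false else xor (tm (n / 2)) (n % 2 == 1)
termination_by n
decreasing_by omega

lemma tm_even (n : ℕ) : tm (2 * n) = tm n := by
  rcases Nat.eq_zero_or_pos n with rfl | h
  · rfl
  · rw [tm, dif_neg (by omega)]
    have h1 : 2 * n / 2 = n := by omega
    have h2 : 2 * n % 2 = 0 := by omega
    rw [h1, h2]; simp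

lemma tm_odd (n : ℕ) : tm (2 * n + 1) = !tm n := by
  rw [tm, dif_neg (by omega)]
  have h1 : (2 * n + 1) / 2 = n := by omega
  have h2 : (2 * n + 1) % 2 = 1 := by omega
  rw [h1, h2]; simp

lemma tm_three (i : ℕ) (h1 : tm i = tm (i + 1)) (h2 : tm (i + 1) = tm (i + 2)) : False := by
  rcases Nat.even_or_odd' i with ⟨m, rfl | rfl⟩
  · rw [tm_even, tm_odd] at h1; simp at h1
  · have e1 : 2 * m + 1 + 1 = 2 * (m + 1) := by ring
    have e2 : 2 * m + 1 + 2 = 2 * (m + 1) + 1 := by ring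
    rw [e1, e2, tm_even, tm_odd] at h2; simp at h2

lemma tm_consec (m : ℕ) (h : tm (2 * m + 1) ≠ tm (2 * m + 2)) : tm m = tm (m + 1) := by
  have e1 : 2 * m + 2 = 2 * (m + 1) := by ring
  rw [e1, tm_even, tm_odd] at h
  revert h; cases tm m <;> cases tm (m + 1) <;> simp

lemma tm_no (p : ℕ) : ∀ (M i : ℕ), 1 ≤ p → 2 ≤ M → 2 * p - 1 ≤ M →
    (∀ k < M, tm (i + k) = tm (i + k + p)) → False := by
  induction p using Nat.strong_induction_on with
  | _ p ih =>
    intro M i hp hM hpM h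
    have h' : ∀ j, i ≤ j → j < i + M → tm j = tm (j + p) := by
      intro j h1 h2
      have := h (j - i) (by omega)
      rwa [show i + (j - i) = j by omega] at this
    rcases Nat.even_or_odd' p with ⟨q, hq | hq⟩
    · refine ih q (by omega) (2 * q) (i / 2) (by omega) (by omega) (by omega) ?_
      intro k hk
      by_cases hc : i ≤ 2 * (i / 2 + k)
      · have := h' (2 * (i / 2 + k)) hc (by omega)
        rw [show 2 * (i / 2 + k) + p = 2 * (i / 2 + k + q) by omega, tm_even, tm_even] at this
        exact this
      · have := h' (2 * (i / 2 + k) + 1) (by omega) (by omega)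
        rw [show 2 * (i / 2 + k) + 1 + p = 2 * (i / 2 + k + q) + 1 by omega,
          tm_odd, tm_odd] at this
        simpa using this
    · rcases Nat.eq_zero_or_pos q with h0 | h0
      · have hp1 : p = 1 := by omega
        subst hp1
        exact tm_three i (h' i (by omega) (by omega)) (h' (i + 1) (by omega) (by omega))
      · obtain ⟨m, hm1, hm2⟩ : ∃ m, i ≤ 2 * m ∧ 2 * m ≤ i + 1 := ⟨(i + 1) / 2, by omega, by omega⟩
        have a0 := h' (2 * m) (by omega) (by omega)
        have a1 := h' (2 * m + 1) (by omega) (by omega)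
        have a2 := h' (2 * (m + 1)) (by omega) (by omega)
        have a3 := h' (2 * (m + 1) + 1) (by omega) (by omega)
        refine tm_three (m + q) (tm_consec _ ?_) (tm_consec (m + q + 1) ?_)
        · rw [show 2 * (m + q) + 1 = 2 * m + p by omega,
            show 2 * (m + q) + 2 = 2 * m + 1 + p by omega, ← a0, ← a1, tm_even, tm_odd]
          simp
        · rw [show 2 * (m + q + 1) + 1 = 2 * (m + 1) + p by omega,
            show 2 * (m + q + 1) + 2 = 2 * (m + 1) + 1 + p by omega, ← a2, ← a3, tm_even, tm_odd]
          simp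

lemma mono_steps (f : ℕ → ℕ) (N : ℕ)
    (h1 : ∀ k < N, f (k + 1) = f k + 1 ∨ f k = f (k + 1) + 1)
    (h2 : ∀ k, k + 1 < N → f k ≠ f (k + 2)) :
    (∀ k ≤ N, f k = f 0 + k) ∨ (∀ k ≤ N, f k + k = f 0) := by
  induction N with
  | zero => left; intro k hk; obtain rfl : k = 0 := by omega
            rfl
  | succ n ih =>
    rcases Nat.eq_zero_or_pos n with rfl | hn
    · rcases h1 0 (by omega) with h | h
      · left; intro k hk; interval_cases k <;> simp_all
      · right; intro k hk; interval_cases k <;> simp_all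
    · have hx := h1 n (by omega)
      have hy := h2 (n - 1) (by omega)
      rw [show n - 1 + 2 = n + 1 by omega] at hy
      rcases ih (fun k hk => h1 k (by omega)) (fun k hk => h2 k (by omega)) with h | h
      · left; intro k hk
        have b1 := h n le_rfl
        have b2 := h (n - 1) (by omega)
        rcases Nat.lt_or_ge k (n + 1) with hk' | hk'
        · exact h k (by omega)
        · obtain rfl : k = n + 1 := by omega
          omega
      · right; intro k hk
        have b1 := h n le_rfl
        have b2 := h (n - 1) (by omega)
        rcases Nat.lt_or_ge k (n + 1) with hk' | hk'
        · exact h k (by omega)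
        · obtain rfl : k = n + 1 := by omega
          omega

lemma tm_core (f : ℕ → ℕ) (p M : ℕ) (hp : 1 ≤ p) (hM : 2 ≤ M) (hpM : 2 * p - 1 ≤ M)
    (h1 : ∀ k < M + p - 1, f (k + 1) = f k + 1 ∨ f k = f (k + 1) + 1)
    (h2 : ∀ k, k + 1 < M + p - 1 → f k ≠ f (k + 2))
    (h : ∀ k < M, tm (f k) = tm (f (k + p))) : False := by
  rcases mono_steps f _ h1 h2 with hf | hf
  · refine tm_no p M (f 0) hp hM hpM fun k hk => ?_
    have := h k hk
    rw [hf k (by omega), hf (k + p) (by omega)] at this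
    simpa [add_assoc] using this
  · refine tm_no p M (f (M + p - 1)) hp hM hpM fun k hk => ?_
    have := h (M - 1 - k) (by omega)
    have e0 := hf (M + p - 1) le_rfl
    have e1 := hf (M - 1 - k) (by omega)
    have e2 := hf (M - 1 - k + p) (by omega)
    rw [show f (M + p - 1) + k + p = f (M - 1 - k) by omega,
      show f (M + p - 1) + k = f (M - 1 - k + p) by omega, this]

lemma slice_walk {V : Type*} (G : SimpleGraph V) (l : List V) (hl : l.Nodup)
    (hc : ∀ i (h : i + 1 < l.length), G.Adj l[i] l[i + 1]) (d : ℕ) :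
    ∀ (i : ℕ) (h : i + d < l.length), ∃ q : G.Walk l[i] l[i + d], q.IsPath ∧ q.length = d ∧
      ∀ v ∈ q.support, ∃ j, ∃ hj : j < l.length, i ≤ j ∧ v = l[j] := by
  induction d with
  | zero => intro i h; exact ⟨Walk.nil, by simp, by simp, by
      intro v hv; exact ⟨i, by omega, le_rfl, by simpa using hv⟩⟩
  | succ d ih =>
    intro i h
    obtain ⟨q, hq, hlen, hs⟩ := ih (i + 1) (by omega)
    have e : l[i + 1 + d] = l[i + (d + 1)] := by congr 1; omega
    refine ⟨(Walk.cons (hc i (by omega)) q).copy rfl e, ?_, ?_, ?_⟩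
    · rw [Walk.isPath_copy, Walk.cons_isPath_iff]
      refine ⟨hq, fun hm => ?_⟩
      obtain ⟨j, hj, hij, hv⟩ := hs _ hm
      have := (hl.getElem_inj_iff).1 hv
      omega
    · simp [hlen]
    · intro v hv
      rw [Walk.support_copy, Walk.support_cons, List.mem_cons] at hv
      rcases hv with rfl | hv
      · exact ⟨i, by omega, le_rfl, rfl⟩
      · obtain ⟨j, hj, hij, hv⟩ := hs _ hv
        exact ⟨j, hj, by omega, hv⟩

lemma adj_consec {V : Type*} (G : SimpleGraph V) (hG : G.IsAcyclic) (l : List V) (hl : l.Nodup)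
    (hc : ∀ i (h : i + 1 < l.length), G.Adj l[i] l[i + 1]) (i j : ℕ) (hj : j < l.length)
    (hij : i < j) (ha : G.Adj l[i] l[j]) : j = i + 1 := by
  obtain ⟨d, rfl⟩ : ∃ d, j = i + d := ⟨j - i, by omega⟩
  obtain ⟨q, hq, hlen, -⟩ := slice_walk G l hl hc d i hj
  have hp : (Walk.cons ha Walk.nil).IsPath := by simp [ha.ne]
  have := hG.path_unique ⟨q, hq⟩ ⟨_, hp⟩
  have h2 : q = Walk.cons ha Walk.nil := congrArg Subtype.val this
  rw [h2] at hlen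
  simp at hlen
  omega

lemma adj_idx {V : Type*} [DecidableEq V] (G : SimpleGraph V) (hG : G.IsAcyclic) (l : List V)
    (hl : l.Nodup) (hc : ∀ i (h : i + 1 < l.length), G.Adj l[i] l[i + 1]) (u v : V) (hu : u ∈ l)
    (hv : v ∈ l) (ha : G.Adj u v) : l.idxOf v = l.idxOf u + 1 ∨ l.idxOf u = l.idxOf v + 1 := by
  have hu' := List.idxOf_lt_length_iff.2 hu
  have hv' := List.idxOf_lt_length_iff.2 hv
  have eu : l[l.idxOf u] = u := List.getElem_idxOf hu'
  have ev : l[l.idxOf v] = v := List.getElem_idxOf hv'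
  rcases lt_trichotomy (l.idxOf u) (l.idxOf v) with h | h | h
  · left; exact adj_consec G hG l hl hc _ _ hv' h (by rw [eu, ev]; exact ha)
  · exact absurd ((List.idxOf_inj hu).1 h) ha.ne
  · right; exact adj_consec G hG l hl hc _ _ hu' h (by rw [eu, ev]; exact ha.symm)

/-- The coloring. -/
noncomputable def catColor {V : Type*} [DecidableEq V] (G : SimpleGraph V) (l : List V) (v : V) :
    Bool :=
  open Classical in
  if v ∈ l then tm (l.idxOf v) else
    if h : ∃ u, G.Adj v u then !tm (l.idxOf h.choose) else false

/-- Every finite caterpillar admits a 2-coloring that is 3⁺-free. -/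
theorem caterpillar_two_coloring_three_plus_free
    {V : Type*} [Fintype V] (G : SimpleGraph V) [DecidableRel G.Adj]
    (hG : IsCaterpillar G) :
    ∃ c : V → Fin 2, ColoringFreePlus G c 3 := by
  classical
  obtain ⟨hT, l, hl, hdeg, hch⟩ := hG
  have hc : ∀ i (h : i + 1 < l.length), G.Adj l[i] l[i + 1] := by
    intro i h
    exact List.isChain_iff_getElem.1 hch i h
  have hin : ∀ v ∈ l, catColor G l v = tm (l.idxOf v) := by
    intro v hv; simp [catColor, hv]
  have hdeg2 : ∀ v a b : V, G.Adj v a → G.Adj v b → a ≠ b → v ∈ l := by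
    intro v a b ha hb hab
    rw [hdeg, ← G.card_neighborFinset_eq_degree]
    exact Finset.one_lt_card.2 ⟨a, by simpa using ha, b, by simpa using hb, hab⟩
  have hout : ∀ v u, v ∉ l → G.Adj v u → catColor G l v = !tm (l.idxOf u) := by
    intro v u hv hu
    have hex : ∃ u, G.Adj v u := ⟨u, hu⟩
    have : hex.choose = u := by
      by_contra hne
      exact hv (hdeg2 v _ _ hex.choose_spec hu hne)
    simp only [catColor, hv, if_false, dif_pos hex, this]
  let φ : Bool → Fin 2 := fun b => if b then 1 else 0
  have hφ : ∀ a b, φ a = φ b → a = b := by decide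
  refine ⟨fun v => φ (catColor G l v), ?_⟩
  rintro u v w hw ⟨P, E, hP, hinf, hpre, hlt⟩
  have hp : 1 ≤ P.length := List.length_pos_iff.2 hP
  have hE : 2 * P.length < E.length := by
    have h0 : (0 : ℝ) < P.length := by exact_mod_cast hp
    rw [lt_div_iff₀ h0] at hlt
    have : (2 * P.length : ℝ) < E.length := by linarith
    exact_mod_cast this
  obtain ⟨A, B, hAB⟩ := hinf
  -- the vertex function
  have hlen : A.length + P.length + E.length + B.length = w.support.length := by
    have := congrArg List.length hAB
    simp at this ⊢; omega
  let s : ℕ → V := fun k => w.getVert (A.length + k)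
  have hs_len : w.support.length = w.length + 1 := w.length_support
  have hs_adj : ∀ k, k + 1 < P.length + E.length → G.Adj (s k) (s (k + 1)) := by
    intro k hk
    exact w.adj_getVert_succ (by omega)
  have hs_inj : ∀ j k, j < P.length + E.length → k < P.length + E.length → s j = s k → j = k := by
    intro j k hj hk h
    have := hw.getVert_injOn (by simp; omega) (by simp; omega) h
    omega
  have hs_col : ∀ k, k < P.length + E.length → (P ++ E)[k]? = some (φ (catColor G l (s k))) := by
    intro k hk
    have h1 : (A ++ (P ++ E) ++ B)[A.length + k]? = (P ++ E)[k]? := by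
      rw [List.append_assoc, List.getElem?_append_right (by omega),
        List.getElem?_append_left (by simp; omega)]
      congr 1; omega
    rw [← h1, hAB, List.getElem?_map, ← Walk.getVert_eq_support_getElem? w (by omega)]
    rfl
  have hper : ∀ k, k < E.length → catColor G l (s k) = catColor G l (s (k + P.length)) := by
    intro k hk
    apply hφ
    have a1 := hs_col k (by omega)
    have a2 := hs_col (k + P.length) (by omega)
    rw [List.getElem?_append_right (by omega), Nat.add_sub_cancel] at a2
    have a3 : E[k]? = (P ++ E)[k]? := by
      obtain ⟨t, ht⟩ := hpre
      rw [← ht, List.getElem?_append_left hk]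
    rw [a3, a1] at a2
    exact Option.some.inj a2
  have hmid : ∀ k, 1 ≤ k → k + 1 < P.length + E.length → s k ∈ l := by
    intro k h1 h2
    have b1 := hs_adj (k - 1) (by omega)
    rw [show k - 1 + 1 = k by omega] at b1
    refine hdeg2 _ _ _ b1.symm (hs_adj k h2) fun h => ?_
    have := hs_inj _ _ (by omega) (by omega) h
    omega
  -- general contradiction with offset
  have main : ∀ o M : ℕ, 2 ≤ M → 2 * P.length - 1 ≤ M → o + M ≤ E.length →
      (∀ k, o ≤ k → k ≤ o + M + P.length - 1 → s k ∈ l) → False := by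
    intro o M hM hpM hoM hmem
    refine tm_core (fun k => l.idxOf (s (o + k))) P.length M hp hM hpM ?_ ?_ ?_
    · intro k hk
      exact adj_idx G hT.IsAcyclic l hl hc _ _ (hmem _ (by omega) (by omega))
        (hmem _ (by omega) (by omega)) (hs_adj (o + k) (by omega))
    · intro k hk h
      have := hs_inj _ _ (by omega) (by omega)
        ((List.idxOf_inj (hmem (o + k) (by omega) (by omega))).1 h)
      omega
    · intro k hk
      have := hper (o + k) (by omega)
      rw [hin _ (hmem _ (by omega) (by omega)), hin _ (hmem _ (by omega) (by omega))] at this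
      simpa [add_assoc] using this
  by_cases hp1 : P.length = 1
  · by_cases h0 : s 0 ∈ l
    · refine main 0 2 le_rfl (by omega) (by omega) fun k _ hk => ?_
      rcases Nat.eq_zero_or_pos k with rfl | hk0
      · exact h0
      · exact hmid k hk0 (by omega)
    · have b := hper 0 (by omega)
      rw [hp1, hout _ _ h0 (hs_adj 0 (by omega)), hin _ (hmid _ (by omega) (by omega))] at b
      simp at b
  · exact main 1 (2 * P.length - 1) (by omega) le_rfl (by omega)
      fun k h1 h2 => hmid k h1 (by omega)
end

section
/- Every 2-coloring of the infinite caterpillar of maximum degree 3 contains a factor that is a repetition of exponent at least 3. -/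
open SimpleGraph

/-- The infinite caterpillar of maximum degree 3: vertex set `ℤ × {false, true}`, where
`(i, false)` is adjacent to `(i+1, false)` and `(i, false)` is adjacent to `(i, true)`. -/
def InfCaterpillar : SimpleGraph (ℤ × Bool) :=
  SimpleGraph.fromRel (fun a b =>
    (a.2 = false ∧ b.2 = false ∧ b.1 = a.1 + 1) ∨ (a.2 = false ∧ b.2 = true ∧ a.1 = b.1))

namespace Cat

/-- the word read off a history of (spine, leaf) pairs, optionally with end leaves -/
def word {α : Type} (S : List (α × α)) (a b : Bool) : List α :=
  (bif a then (S.head?.map Prod.snd).toList else []) ++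
    (S.map Prod.fst ++ (bif b then (S.getLast?.map Prod.snd).toList else []))

theorem word_map {α β : Type} (f : α → β) (S : List (α × α)) (a b : Bool) :
    word (S.map (Prod.map f f)) a b = (word S a b).map f := by
  cases a <;> cases b <;> simp [word, Function.comp_def, Option.toList_map]

theorem word_cons_cons {α : Type} (x y : α × α) (S : List (α × α)) (b : Bool) :
    word (x :: y :: S) false b = x.1 :: word (y :: S) false b := by
  simp [word]

theorem word_true {α : Type} (x : α × α) (S : List (α × α)) (b : Bool) :
    word (x :: S) true b = x.2 :: word (x :: S) false b := by
  simp [word]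

/-- `pre x y`: the word `x` is a prefix of `y` -/
def pre (x : List Bool) : List Bool → Bool :=
  List.rec (fun _ => true)
    (fun a _ ih y => List.rec false (fun b t _ =>
      Bool.rec (Bool.rec (ih t) false b) (Bool.rec false (ih t) b) a) y) x

theorem pre_prefix : ∀ x y, pre x y = true → x <+: y
  | [], y, _ => List.nil_prefix
  | _ :: _, [], h => by simp [pre] at h
  | true :: x, true :: y, h => by simpa using pre_prefix x y h
  | false :: x, false :: y, h => by simpa using pre_prefix x y h
  | true :: x, false :: y, h => by simp [pre] at h
  | false :: x, true :: y, h => by simp [pre] at h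

def isCube (p : ℕ) (w : List Bool) : Bool :=
  pre (Nat.rec w (fun _ l => l.tail) p) w && Nat.beq w.length (3 * p)

/-- quick filter: the first `n` spine colors of `x` and `y` agree -/
def agree (n : ℕ) : List (Bool × Bool) → List (Bool × Bool) → Bool :=
  Nat.rec (fun _ _ => true)
    (fun _ ih x y => List.rec false (fun a s _ => List.rec false (fun b t _ =>
      Bool.rec (Bool.rec (ih s t) false b.1) (Bool.rec false (ih s t) b.1) a.1) y) x) n

/-- `m` spine colors, followed by the leaf color at the last of them if `b` -/
def spine (b : Bool) (m : ℕ) : List (Bool × Bool) → List Bool :=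
  Nat.rec (fun _ => [])
    (fun k ih h => List.rec [] (fun x t _ => x.1 ::
      Nat.rec (Bool.rec [] [x.2] b) (fun _ _ => ih t) k) h) m

theorem spine_eq (b : Bool) (m : ℕ) (h : List (Bool × Bool)) (hm : m ≤ h.length) :
    spine b m h = word (h.take m) false b := by
  induction m generalizing h with
  | zero => cases b <;> simp [spine, word]
  | succ m ih =>
    cases h with
    | nil => simp at hm
    | cons x t =>
      cases m with
      | zero => cases b <;> simp [spine, word]
      | succ m =>
        have hm' : m + 1 ≤ t.length := by simpa using hm
        cases t with
        | nil => simp at hm'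
        | cons y t =>
          have := ih (y :: t) hm'
          rw [List.take_succ_cons] at this ⊢
          rw [List.take_succ_cons, word_cons_cons, ← this]
          rfl

def cword (h : List (Bool × Bool)) (m : ℕ) (a b : Bool) : List Bool :=
  Bool.rec (spine b m h) (List.rec [] (fun x _ _ => x.2 :: spine b m h) h) a

theorem cword_eq (a b : Bool) (m : ℕ) (h : List (Bool × Bool)) (hm : m ≤ h.length)
    (hm0 : 0 < m) : cword h m a b = word (h.take m) a b := by
  cases h with
  | nil => simp at hm; omega
  | cons x t =>
    cases a with
    | false => exact spine_eq b m _ hm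
    | true =>
      have := spine_eq b m _ hm
      obtain ⟨m, rfl⟩ : ∃ n, m = n + 1 := ⟨m - 1, by omega⟩
      rw [List.take_succ_cons] at this ⊢
      rw [word_true, ← this]
      rfl

/-- does the color word of the shape with period `p`, `m` spine vertices and leaf flags `a`, `b`
form a cube? -/
def chk (h : List (Bool × Bool)) (p m : ℕ) (a b : Bool) : Bool :=
  isCube p (cword h m a b) && Nat.ble m h.length

def bad (h : List (Bool × Bool)) : Bool :=
  (agree 1 h.tail h && (chk h 1 2 true false || (chk h 1 2 false true || chk h 1 3 false false))) ||
  ((agree 2 h.tail.tail h && (chk h 2 4 true true || (chk h 2 5 true false ||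
    (chk h 2 5 false true || chk h 2 6 false false)))) ||
  ((agree 4 h.tail.tail.tail h && (chk h 3 7 true true || (chk h 3 8 true false ||
    (chk h 3 8 false true || chk h 3 9 false false)))) ||
  (agree 6 h.tail.tail.tail.tail h && (chk h 4 10 true true || (chk h 4 11 true false ||
    (chk h 4 11 false true || chk h 4 12 false false))))))

theorem bad_chk (h : List (Bool × Bool)) (hb : bad h = true) :
    ∃ p m a b, chk h p m a b = true ∧ 0 < p ∧ 0 < m ∧ (a = true → b = true → 2 ≤ m) := by
  simp only [bad, Bool.or_eq_true, Bool.and_eq_true] at hb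
  rcases hb with ⟨-, h | h | h⟩ | (⟨-, h | h | h | h⟩ | ⟨-, h | h | h | h⟩ | ⟨-, h | h | h | h⟩) <;>
    exact ⟨_, _, _, _, h, by decide, by decide, by decide⟩

def search (n : ℕ) : List (Bool × Bool) → Bool :=
  Nat.rec (fun h => bad h) (fun _ ih h => bad h ||
      (ih ((false, false) :: h) && (ih ((false, true) :: h) &&
        (ih ((true, false) :: h) && ih ((true, true) :: h))))) n

theorem search_succ (n : ℕ) (h : List (Bool × Bool)) : search (n + 1) h = (bad h ||
      (search n ((false, false) :: h) && (search n ((false, true) :: h) &&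
        (search n ((true, false) :: h) && search n ((true, true) :: h))))) := rfl

theorem search_ok : search 17 [] = true := by decide +kernel

def vh : ℤ → ℕ → List ((ℤ × Bool) × (ℤ × Bool))
  | _, 0 => []
  | i, k + 1 => ((i, false), (i, true)) :: vh (i - 1) k

theorem vh_take (i : ℤ) (k m : ℕ) (h : m ≤ k) : (vh i k).take m = vh i m := by
  induction k generalizing i m with
  | zero => obtain rfl : m = 0 := by omega
            rfl
  | succ k ih =>
    cases m with
    | zero => rfl
    | succ m => simp [vh, ih (i - 1) m (by omega)]

theorem vh_length (i : ℤ) (k : ℕ) : (vh i k).length = k := by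
  induction k generalizing i with
  | zero => rfl
  | succ k ih => simp [vh, ih]

theorem search_bad (d : ℤ × Bool → Bool) (n : ℕ) (i : ℤ) (k : ℕ)
    (h : search n ((vh i k).map (Prod.map d d)) = true) :
    ∃ i k, bad ((vh i k).map (Prod.map d d)) = true := by
  induction n generalizing i k with
  | zero => exact ⟨i, k, h⟩
  | succ n ih =>
    simp only [search_succ, Bool.or_eq_true, Bool.and_eq_true] at h
    rcases h with h | ⟨h1, h2, h3, h4⟩
    · exact ⟨i, k, h⟩
    · apply ih (i + 1) (k + 1)
      simp only [vh, List.map_cons, add_sub_cancel_right, Prod.map_apply]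
      cases d (i + 1, false) <;> cases d (i + 1, true) <;> assumption

theorem adj_spine (i : ℤ) : InfCaterpillar.Adj (i, false) (i - 1, false) := by
  simp [InfCaterpillar, SimpleGraph.fromRel_adj]
  omega

theorem adj_leaf (i : ℤ) : InfCaterpillar.Adj (i, false) (i, true) := by
  simp [InfCaterpillar, SimpleGraph.fromRel_adj]

theorem word_head (i : ℤ) (m : ℕ) (b : Bool) :
    ∃ T, word (vh i (m + 1)) false b = (i, false) :: T := by
  simp [word, vh]

theorem mem_word (i : ℤ) (m : ℕ) (b : Bool) (v : ℤ × Bool)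
    (h : v ∈ word (vh i (m + 1)) false b) :
    v.1 ≤ i ∧ (v.2 = true → b = true ∧ v.1 = i - m) := by
  induction m generalizing i with
  | zero =>
    cases b <;> simp [word, vh] at h
    · subst h; simp
    · rcases h with rfl | rfl <;> simp
  | succ m ih =>
    rw [vh, vh, word_cons_cons, List.mem_cons] at h
    rcases h with rfl | h
    · simp
    · have := ih (i - 1) (by rw [vh]; exact h)
      refine ⟨by omega, fun hv => ⟨(this.2 hv).1, ?_⟩⟩
      have := (this.2 hv).2
      push_cast; omega

theorem word_false_path (i : ℤ) (m : ℕ) (b : Bool) :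
    (word (vh i (m + 1)) false b).IsChain InfCaterpillar.Adj ∧
      (word (vh i (m + 1)) false b).Nodup := by
  induction m generalizing i with
  | zero => cases b <;> simp [word, vh, adj_leaf]
  | succ m ih =>
    obtain ⟨h1, h2⟩ := ih (i - 1)
    have e : word (vh i (m + 1 + 1)) false b = (i, false) :: word (vh (i - 1) (m + 1)) false b := by
      rw [vh, vh, word_cons_cons]
    rw [e]
    constructor
    · obtain ⟨T, hT⟩ := word_head (i - 1) m b
      rw [hT] at h1 ⊢
      exact List.isChain_cons_cons.2 ⟨adj_spine i, h1⟩
    · refine List.nodup_cons.2 ⟨fun hm => ?_, h2⟩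
      have := (mem_word _ _ _ _ hm).1
      simp at this

theorem word_path (i : ℤ) (m : ℕ) (a b : Bool) (hab : a = true → b = true → 1 ≤ m) :
    (word (vh i (m + 1)) a b).IsChain InfCaterpillar.Adj ∧
      (word (vh i (m + 1)) a b).Nodup := by
  cases a with
  | false => exact word_false_path i m b
  | true =>
    obtain ⟨h1, h2⟩ := word_false_path i m b
    have e : word (vh i (m + 1)) true b = (i, true) :: word (vh i (m + 1)) false b := by
      rw [vh, word_true]
    rw [e]
    constructor
    · obtain ⟨T, hT⟩ := word_head i m b
      rw [hT] at h1 ⊢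
      exact List.isChain_cons_cons.2 ⟨(adj_leaf i).symm, h1⟩
    · refine List.nodup_cons.2 ⟨fun hm => ?_, h2⟩
      have := (mem_word _ _ _ _ hm).2 rfl
      have h3 := hab rfl this.1
      have := this.2
      simp at this
      omega

theorem exists_walk {V : Type} (G : SimpleGraph V) (l : List V) (v : V)
    (h : (v :: l).IsChain G.Adj) : ∃ (u : V) (p : G.Walk v u), p.support = v :: l := by
  induction l generalizing v with
  | nil => exact ⟨v, .nil, rfl⟩
  | cons x l ih =>
    rw [List.isChain_cons_cons] at h
    obtain ⟨u, p, hp⟩ := ih x h.2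
    exact ⟨u, .cons h.1 p, by simp [hp]⟩

theorem rep_of_cube (p : ℕ) (hp : 0 < p) (w : List Bool) (g : Bool → Fin 2)
    (h : isCube p w = true) : HasRepGE 3 (w.map g) := by
  simp only [isCube, Bool.and_eq_true] at h
  have hl : w.length = 3 * p := Nat.eq_of_beq_eq_true h.2
  have hdrop : ∀ p : ℕ, (Nat.rec w (fun _ l => l.tail) p : List Bool) = w.drop p := by
    intro p
    induction p with
    | zero => rfl
    | succ p ih => rw [← List.tail_drop, ← ih]
  rw [hdrop] at h
  have he := pre_prefix _ _ h.1
  refine ⟨(w.map g).take p, (w.map g).drop p, ?_, ?_, ?_, ?_⟩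
  · intro h0
    have := congrArg List.length h0
    simp only [List.length_take, List.length_map, List.length_nil] at this
    omega
  · simp
  · rw [List.take_append_drop, ← List.map_drop]
    exact he.map g
  · have e1 : ((w.map g).take p).length = p := by simp; omega
    have e2 : ((w.map g).drop p).length = 2 * p := by simp; omega
    rw [e1, e2]
    have : (0 : ℝ) < p := by exact_mod_cast hp
    rw [le_div_iff₀ this]
    push_cast
    linarith

end Cat

open Cat in
/-- Every 2-coloring of the infinite caterpillar of maximum degree 3 contains a factor
that is a repetition of exponent at least 3. -/
theorem infCaterpillar_two_coloring_hasRep_three (c : ℤ × Bool → Fin 2) :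
    ColoringHasRepGE InfCaterpillar c 3 := by
  set d : ℤ × Bool → Bool := fun v => decide (c v = 1) with hd
  set g : Bool → Fin 2 := fun b => if b then 1 else 0 with hg
  have hc : c = g ∘ d := by
    funext v
    simp only [hg, hd, Function.comp]
    generalize c v = x
    revert x
    decide
  obtain ⟨i, k, h⟩ := search_bad d 17 0 0 search_ok
  obtain ⟨p, m, a, b, h, hp, hm, hab⟩ := bad_chk _ h
  simp only [chk, Bool.and_eq_true, List.length_map, vh_length] at h
  obtain ⟨h, hk⟩ := h
  have hk := Nat.le_of_ble_eq_true hk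
  rw [cword_eq _ _ _ _ (by simpa [vh_length] using hk) hm, ← List.map_take, vh_take _ _ _ hk,
    word_map] at h
  obtain ⟨m, rfl⟩ : ∃ n, m = n + 1 := ⟨m - 1, by omega⟩
  obtain ⟨h1, h2⟩ := word_path i m a b (fun x y => by have := hab x y; omega)
  have hr := rep_of_cube p hp _ g h
  rw [List.map_map, ← hc] at hr
  generalize hw : word (vh i (m + 1)) a b = w at *
  cases w with
  | nil =>
    exfalso
    cases a <;> simp [word, vh] at hw
  | cons v l =>
    obtain ⟨u, q, hq⟩ := exists_walk _ l v h1
    exact ⟨v, u, q, by rw [SimpleGraph.Walk.isPath_def, hq]; exact h2, by rw [hq]; exact hr⟩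
end

section
/- Every finite caterpillar admits a 3-coloring that is 2⁺-free, i.e., a coloring with 3 colors in which no factor contains a repetition of exponent strictly greater than 2. -/
open SimpleGraph

/-- Thue-Morse sequence. -/
def tmSeq (n : ℕ) : Bool :=
  if h : n = 0 then false else xor (tmSeq (n / 2)) (decide (n % 2 = 1))
termination_by n
decreasing_by omega

lemma tmSeq_even (n : ℕ) : tmSeq (2 * n) = tmSeq n := by
  rcases Nat.eq_zero_or_pos n with h | h
  · subst h; rfl
  · rw [tmSeq, dif_neg (by omega)]
    have h1 : 2 * n / 2 = n := by omega
    have h2 : ¬ (2 * n % 2 = 1) := by omega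
    rw [h1]; simp

lemma tmSeq_odd (n : ℕ) : tmSeq (2 * n + 1) = !tmSeq n := by
  rw [tmSeq, dif_neg (by omega)]
  have h1 : (2 * n + 1) / 2 = n := by omega
  have h2 : (2 * n + 1) % 2 = 1 := by omega
  rw [h1, h2]; simp

lemma tmSeq_no_cube (i : ℕ) (h1 : tmSeq i = tmSeq (i + 1)) (h2 : tmSeq (i + 1) = tmSeq (i + 2)) :
    False := by
  obtain ⟨j, hj | hj⟩ := Nat.even_or_odd' i
  · subst hj
    rw [tmSeq_even, tmSeq_odd] at h1
    cases h : tmSeq j <;> simp [h] at h1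
  · subst hj
    have e1 : 2 * j + 1 + 1 = 2 * (j + 1) := by ring
    have e2 : 2 * j + 1 + 2 = 2 * (j + 1) + 1 := by ring
    rw [e1, e2, tmSeq_even, tmSeq_odd] at h2
    cases h : tmSeq (j + 1) <;> simp [h] at h2

/-- If two consecutive aligned pairs reappear at odd positions, contradiction. -/
lemma tmSeq_shift (a b : ℕ) (h0 : tmSeq (2 * a) = tmSeq (2 * b + 1))
    (h1 : tmSeq (2 * a + 1) = tmSeq (2 * b + 2)) (h2 : tmSeq (2 * a + 2) = tmSeq (2 * b + 3))
    (h3 : tmSeq (2 * a + 3) = tmSeq (2 * b + 4)) : False := by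
  have e1 : 2 * b + 2 = 2 * (b + 1) := by ring
  have e2 : 2 * b + 3 = 2 * (b + 1) + 1 := by ring
  have e3 : 2 * b + 4 = 2 * (b + 2) := by ring
  have e4 : 2 * a + 2 = 2 * (a + 1) := by ring
  have e5 : 2 * a + 3 = 2 * (a + 1) + 1 := by ring
  rw [tmSeq_even, tmSeq_odd] at h0
  rw [tmSeq_odd, e1, tmSeq_even] at h1
  rw [e4, e2, tmSeq_even, tmSeq_odd] at h2
  rw [e5, e3, tmSeq_even, tmSeq_odd] at h3
  refine tmSeq_no_cube b ?_ ?_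
  · rw [← h1, h0]; simp
  · rw [← h3, h2]; simp

lemma tmSeq_overlap_free (P : ℕ) : ∀ i : ℕ, 0 < P →
    (∀ k ≤ P, tmSeq (i + k) = tmSeq (i + k + P)) → False := by
  induction P using Nat.strong_induction_on with
  | _ P ih =>
    intro i hP h
    obtain ⟨q, hq | hq⟩ := Nat.even_or_odd' P
    · subst hq
      refine ih q (by omega) (i / 2) (by omega) fun k hk => ?_
      have := h (2 * k) (by omega)
      obtain ⟨j, hj | hj⟩ := Nat.even_or_odd' i
      · have e1 : i + 2 * k = 2 * (i / 2 + k) := by omega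
        have e2 : i + 2 * k + 2 * q = 2 * (i / 2 + k + q) := by omega
        rwa [e2, e1, tmSeq_even, tmSeq_even] at this
      · have e1 : i + 2 * k = 2 * (i / 2 + k) + 1 := by omega
        have e2 : i + 2 * k + 2 * q = 2 * (i / 2 + k + q) + 1 := by omega
        rw [e2, e1, tmSeq_odd, tmSeq_odd] at this
        simpa using this
    · rcases Nat.eq_zero_or_pos q with h0 | h0
      · have hP1 : P = 1 := by omega
        subst hP1
        exact tmSeq_no_cube i (h 0 (by omega)) (h 1 (by omega))
      · have g0 := h 0 (by omega)
        have g1 := h 1 (by omega)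
        have g2 := h 2 (by omega)
        have g3 := h 3 (by omega)
        obtain ⟨j, hj | hj⟩ := Nat.even_or_odd' i
        · apply tmSeq_shift j (j + q)
          · convert g0 using 2 <;> omega
          · convert g1 using 2 <;> omega
          · convert g2 using 2 <;> omega
          · convert g3 using 2 <;> omega
        · apply tmSeq_shift (j + q + 1) j
          · convert g0.symm using 2 <;> omega
          · convert g1.symm using 2 <;> omega
          · convert g2.symm using 2 <;> omega
          · convert g3.symm using 2 <;> omega

lemma steps_monotone (D : ℕ → ℤ) (N : ℕ) (h1 : ∀ k < N, D (k + 1) = D k + 1 ∨ D (k + 1) = D k - 1)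
    (h2 : ∀ k, k + 2 ≤ N → D (k + 2) ≠ D k) :
    (∀ k ≤ N, D k = D 0 + k) ∨ (∀ k ≤ N, D k = D 0 - k) := by
  induction N with
  | zero => left; intro k hk; obtain rfl : k = 0 := by omega
            simp
  | succ N ih =>
    have ih := ih (fun k hk => h1 k (by omega)) (fun k hk => h2 k (by omega))
    have a := h1 N (by omega)
    rcases Nat.eq_zero_or_pos N with h0 | h0
    · subst h0
      rcases a with a | a
      · left; intro k hk
        obtain rfl | rfl : k = 0 ∨ k = 1 := by omega
        · simp
        · simpa using a
      · right; intro k hk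
        obtain rfl | rfl : k = 0 ∨ k = 1 := by omega
        · simp
        · simpa using a
    · obtain ⟨M, rfl⟩ : ∃ M, N = M + 1 := ⟨N - 1, by omega⟩
      have b := h2 M (by omega)
      rcases ih with ih | ih
      · left; intro k hk
        have c1 := ih (M + 1) (by omega)
        have c2 := ih M (by omega)
        rcases Nat.lt_or_ge k (M + 2) with hk' | hk'
        · exact ih k (by omega)
        · obtain rfl : k = M + 1 + 1 := by omega
          push_cast at *
          have b' : D (M + 1 + 1) ≠ D M := b
          omega
      · right; intro k hk
        have c1 := ih (M + 1) (by omega)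
        have c2 := ih M (by omega)
        rcases Nat.lt_or_ge k (M + 2) with hk' | hk'
        · exact ih k (by omega)
        · obtain rfl : k = M + 1 + 1 := by omega
          push_cast at *
          have b' : D (M + 1 + 1) ≠ D M := b
          omega

lemma chain_length_two {V : Type*} {G : SimpleGraph V} (hG : G.IsAcyclic) (m : List V)
    (hne : m ≠ []) (hnd : m.Nodup) (hc : m.IsChain G.Adj)
    (ha : G.Adj (m.head hne) (m.getLast hne)) : m.length = 2 := by
  have hp : (Walk.ofSupport m hne hc).IsPath := by
    rw [Walk.isPath_def, Walk.support_ofSupport]; exact hnd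
  have hq : (Walk.cons ha Walk.nil).IsPath := by
    simp [ha.ne]
  have := (hG.subsingleton_path _ _).elim ⟨_, hp⟩ ⟨_, hq⟩
  have h2 := congrArg (fun w => w.1.length) this
  simp at h2
  omega

lemma idx_adj {V : Type*} {G : SimpleGraph V} (hG : G.IsAcyclic) (l : List V)
    (hnd : l.Nodup) (hc : l.IsChain G.Adj) (i j : ℕ) (hij : i < j) (hj : j < l.length)
    (ha : G.Adj l[i] l[j]) : j = i + 1 := by
  have hlen : ((l.drop i).take (j - i + 1)).length = j - i + 1 := by
    simp; omega
  have hne : (l.drop i).take (j - i + 1) ≠ [] := by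
    intro h; rw [h] at hlen; simp at hlen
  have := chain_length_two hG ((l.drop i).take (j - i + 1)) hne
    ((hnd.sublist (List.drop_sublist _ _)).sublist (List.take_sublist _ _))
    ((hc.drop i).take _) (by
      rw [List.head_eq_getElem, List.getLast_eq_getElem]
      simp only [List.getElem_take, List.getElem_drop, hlen]
      convert ha using 2
      all_goals omega)
  omega

/-- Every finite caterpillar admits a 3-coloring that is 2⁺-free. -/
theorem caterpillar_three_coloring_two_plus_free
    {V : Type*} [Fintype V] (G : SimpleGraph V) [DecidableRel G.Adj]
    (hG : IsCaterpillar G) :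
    ∃ c : V → Fin 3, ColoringFreePlus G c 2 := by
  classical
  obtain ⟨hT, l, hnd, hl, hc⟩ := hG
  replace hc : l.IsChain G.Adj := hc
  let g : Bool → Fin 3 := fun b => if b then 1 else 0
  have hg2 : ∀ b, g b ≠ 2 := by decide
  have hginj : ∀ a b, g a = g b → a = b := by decide
  let c : V → Fin 3 := fun v => if v ∈ l then g (tmSeq (l.idxOf v)) else 2
  have hcin : ∀ v, v ∈ l → c v = g (tmSeq (l.idxOf v)) := fun v hv => if_pos hv
  have hcout : ∀ v, v ∉ l → c v = 2 := fun v hv => if_neg hv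
  refine ⟨c, ?_⟩
  rintro u v w hw ⟨p, e, hp, ⟨s, t, hst⟩, hpre, hexp⟩
  have hP : 0 < p.length := List.length_pos_iff.mpr hp
  have hlt : p.length < e.length := by
    have h0 : (0 : ℝ) < p.length := by exact_mod_cast hP
    rw [lt_div_iff₀ h0] at hexp
    have : (p.length : ℝ) < e.length := by linarith
    exact_mod_cast this
  set P := p.length with hPdef
  set o := s.length with hodef
  have hlen : o + 2 * P ≤ w.length := by
    have := congrArg List.length hst
    simp at this
    omega
  let f : ℕ → V := fun k => w.getVert (o + k)
  have hf : ∀ k ≤ 2 * P, (p ++ e)[k]? = some (c (f k)) := by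
    intro k hk
    have h1 : (List.map c w.support)[o + k]? = some (c (f k)) := by
      rw [List.getElem?_map, ← Walk.getVert_eq_support_getElem? w (by omega)]
      rfl
    have h2 : (s ++ (p ++ e) ++ t)[o + k]? = (p ++ e)[k]? := by
      rw [List.append_assoc, List.getElem?_append_right (by omega),
        List.getElem?_append_left (by rw [List.length_append]; omega)]
      congr 1; omega
    rw [← h1, ← hst, h2]
  have hcol : ∀ k ≤ P, c (f k) = c (f (k + P)) := by
    intro k hk
    have h1 := hf k (by omega)
    have h2 := hf (k + P) (by omega)
    rw [List.getElem?_append_right (by omega)] at h2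
    have h3 : k + P - p.length = k := by omega
    rw [h3] at h2
    have h4 : e[k]? = (p ++ e)[k]? := by
      obtain ⟨r, hr⟩ := hpre
      rw [← hr, List.getElem?_append_left (by omega)]
    rw [h4, h1] at h2
    simpa using h2
  have hinj : ∀ a b, a ≤ 2 * P → b ≤ 2 * P → f a = f b → a = b := by
    intro a b ha hb hab
    have := hw.getVert_injOn (show o + a ≤ w.length by omega) (show o + b ≤ w.length by omega) hab
    omega
  have hadj : ∀ k < 2 * P, G.Adj (f k) (f (k + 1)) := fun k hk =>
    w.adj_getVert_succ (by omega)
  have hint : ∀ k, 0 < k → k < 2 * P → f k ∈ l := by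
    intro k h0 hk
    rw [hl]
    have a1 := hadj k hk
    have a2 := hadj (k - 1) (by omega)
    rw [show k - 1 + 1 = k by omega] at a2
    rw [← G.card_neighborFinset_eq_degree]
    refine Finset.one_lt_card.mpr ⟨f (k + 1), by simpa using a1, f (k - 1), by simpa using a2.symm, ?_⟩
    intro h
    have := hinj _ _ (by omega) (by omega) h
    omega
  have hmid := hint P hP (by omega)
  have hmem : ∀ k ≤ 2 * P, f k ∈ l := by
    intro k hk
    by_contra hn
    have hc2 := hcout _ hn
    have hm := hcin _ hmid
    rcases Nat.eq_zero_or_pos k with h0 | h0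
    · subst h0
      have := hcol 0 (by omega)
      rw [Nat.zero_add, hc2, hm] at this
      exact hg2 _ this.symm
    · rcases Nat.lt_or_ge k (2 * P) with h1 | h1
      · exact hn (hint k h0 h1)
      · obtain rfl : k = P + P := by omega
        have := hcol P le_rfl
        rw [hc2, hm] at this
        exact hg2 _ this
  let I : ℕ → ℕ := fun k => l.idxOf (f k)
  have hI : ∀ k ≤ P, tmSeq (I k) = tmSeq (I (k + P)) := by
    intro k hk
    have := hcol k hk
    rw [hcin _ (hmem k (by omega)), hcin _ (hmem (k + P) (by omega))] at this
    exact hginj _ _ this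
  have hIlt : ∀ k ≤ 2 * P, I k < l.length := fun k hk => List.idxOf_lt_length_iff.mpr (hmem k hk)
  have hIget : ∀ k (hk : k ≤ 2 * P), l[I k]'(hIlt k hk) = f k := fun k hk =>
    List.getElem_idxOf _
  have hIinj : ∀ a b, a ≤ 2 * P → b ≤ 2 * P → I a = I b → a = b := by
    intro a b ha hb hab
    apply hinj a b ha hb
    rw [← hIget a ha, ← hIget b hb]
    simp only [hab]
  have hmono := steps_monotone (fun k => (I k : ℤ)) (2 * P) (by
    intro k hk
    have ha := hadj k hk
    have hne : I k ≠ I (k + 1) := fun h => by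
      have := hIinj _ _ (by omega) (by omega) h
      omega
    rw [← hIget k (by omega), ← hIget (k + 1) (by omega)] at ha
    rcases Nat.lt_or_gt_of_ne hne with h | h
    · have := idx_adj hT.2 l hnd hc _ _ h _ ha
      left; omega
    · have := idx_adj hT.2 l hnd hc _ _ h _ ha.symm
      right; omega) (by
    intro k hk h
    have := hIinj _ _ (by omega) (by omega) (Int.ofNat.inj h)
    omega)
  rcases hmono with hm | hm
  · refine tmSeq_overlap_free P (I 0) hP fun k hk => ?_
    have h1 := hm k (by omega)
    have h2 := hm (k + P) (by omega)
    rw [show I 0 + k = I k by omega, show I k + P = I (k + P) by omega]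
    exact hI k hk
  · refine tmSeq_overlap_free P (I (2 * P)) hP fun k hk => ?_
    have h0 := hm (2 * P) (by omega)
    have h1 := hm (P - k) (by omega)
    have h2 := hm (P - k + P) (by omega)
    rw [show I (2 * P) + k = I (P - k + P) by omega, show I (P - k + P) + P = I (P - k) by omega]
    exact (hI (P - k) (by omega)).symm
end

section
/- Every 3-coloring of the infinite caterpillar of maximum degree 3 contains a factor that is a repetition of exponent at least 2 (i.e., a square). -/
open SimpleGraph

namespace CatProof

/-- Color of vertex `v` according to the finite list of (spine, leaf) colors. -/
def col (st : List (Fin 3 × Fin 3)) (v : ℕ × Bool) : Fin 3 :=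
  bif v.2 then (st.getD v.1 (0, 0)).2 else (st.getD v.1 (0, 0)).1

/-- Adjacency in the caterpillar, as a boolean. -/
def adjb (a b : ℕ × Bool) : Bool :=
  (!a.2 && !b.2 && Nat.beq b.1 (a.1 + 1)) || (!a.2 && b.2 && Nat.beq a.1 b.1) ||
  (!b.2 && !a.2 && Nat.beq a.1 (b.1 + 1)) || (!b.2 && a.2 && Nat.beq b.1 a.1)

/-- Boolean test that consecutive entries are adjacent. -/
def chainb : List (ℕ × Bool) → Bool
  | [] => true
  | [_] => true
  | a :: b :: l => adjb a b && chainb (b :: l)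

/-- Candidate paths that end at position `n - 1`. -/
def paths (n : ℕ) : List (List (ℕ × Bool)) :=
  (List.range n).flatMap fun i =>
    let a := (List.range' i (n - i)).map fun j => (j, false)
    [a, (i, true) :: a, a ++ [(n - 1, true)], (i, true) :: (a ++ [(n - 1, true)])]

/-- `p` is a genuine nonempty path inside the first positions whose word is a square. -/
def sqPath (st : List (Fin 3 × Fin 3)) (p : List (ℕ × Bool)) : Bool :=
  let w := p.map (col st)
  decide (w.take (p.length / 2) = w.drop (p.length / 2)) && decide (p ≠ []) &&
    chainb p && decide p.Nodup && p.all fun v => decide (v.1 < st.length)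

/-- The finite coloring has a square ending at its last position. -/
def bad (st : List (Fin 3 × Fin 3)) : Bool := (paths st.length).any (sqPath st)

/-- All pairs of colors. -/
def prs : List (Fin 3 × Fin 3) :=
  [(0, 0), (0, 1), (0, 2), (1, 0), (1, 1), (1, 2), (2, 0), (2, 1), (2, 2)]

/-- Exhaustive search. -/
def search : ℕ → List (Fin 3 × Fin 3) → Bool
  | 0, st => bad st
  | k + 1, st => bad st || prs.all fun x => search k (st ++ [x])

lemma mem_prs (x : Fin 3 × Fin 3) : x ∈ prs := by
  revert x; decide

lemma search_spec (f : ℕ → Fin 3 × Fin 3) (k n : ℕ)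
    (h : search k ((List.range n).map f) = true) : ∃ m, bad ((List.range m).map f) = true := by
  induction k generalizing n with
  | zero => exact ⟨n, h⟩
  | succ k ih =>
    simp only [search, Bool.or_eq_true, List.all_eq_true] at h
    rcases h with h | h
    · exact ⟨n, h⟩
    · apply ih (n + 1)
      have := h (f n) (mem_prs _)
      simpa [List.range_succ] using this

lemma search_true : search 8 [] = true := by decide +kernel

/-- Inclusion of the positions. -/
def emb (v : ℕ × Bool) : ℤ × Bool := ((v.1 : ℤ), v.2)

lemma emb_inj : Function.Injective emb := by
  rintro ⟨a, b⟩ ⟨a', b'⟩ h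
  simp [emb] at h
  simp [h]

lemma adj_of_adjb {a b : ℕ × Bool} (h : adjb a b = true) :
    InfCaterpillar.Adj (emb a) (emb b) := by
  obtain ⟨a, x⟩ := a
  obtain ⟨b, y⟩ := b
  cases x <;> cases y <;>
    simp [adjb, InfCaterpillar, SimpleGraph.fromRel_adj, emb, Nat.beq_eq] at h ⊢ <;> omega

lemma exists_walk (a : ℕ × Bool) (l : List (ℕ × Bool)) (h : chainb (a :: l) = true) :
    ∃ (v : ℤ × Bool) (p : InfCaterpillar.Walk (emb a) v), p.support = (a :: l).map emb := by
  induction l generalizing a with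
  | nil => exact ⟨_, Walk.nil, by simp⟩
  | cons b l ih =>
    simp only [chainb, Bool.and_eq_true] at h
    obtain ⟨v, p, hp⟩ := ih b h.2
    exact ⟨v, Walk.cons (adj_of_adjb h.1) p, by simp [hp]⟩

end CatProof

open CatProof in
/-- Every 3-coloring of the infinite caterpillar of maximum degree 3 contains a factor
that is a repetition of exponent at least 2 (a square). -/
theorem infCaterpillar_three_coloring_hasRep_two (c : ℤ × Bool → Fin 3) :
    ColoringHasRepGE InfCaterpillar c 2 := by
  obtain ⟨m, hm⟩ := search_spec (fun n => (c ((n : ℤ), false), c ((n : ℤ), true))) 8 0 search_true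
  simp only [bad, List.any_eq_true] at hm
  obtain ⟨p, -, hp⟩ := hm
  simp only [sqPath, Bool.and_eq_true, decide_eq_true_eq, List.all_eq_true] at hp
  obtain ⟨⟨⟨⟨hsq, hne⟩, hch⟩, hnd⟩, hlt⟩ := hp
  have hw : p.map (col ((List.range m).map
      (fun n : ℕ => (c ((n : ℤ), false), c ((n : ℤ), true))))) = (p.map emb).map c := by
    rw [List.map_map]
    apply List.map_congr_left
    intro v hv
    have hv' := hlt v hv
    simp only [List.length_map, List.length_range] at hv'
    obtain ⟨i, b⟩ := v
    cases b <;> simp [col, emb, List.getD, hv']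
  rw [hw] at hsq
  obtain ⟨a, l, rfl⟩ := List.exists_cons_of_ne_nil hne
  obtain ⟨v, q, hq⟩ := exists_walk a l hch
  refine ⟨_, v, q, ?_, ?_⟩
  · rw [Walk.isPath_def, hq]
    exact hnd.map emb_inj
  · rw [hq]
    set w := ((a :: l).map emb).map c with hwd
    have hlen : w.length = (a :: l).length := by simp [w]
    have hpos : 0 < (a :: l).length := by simp
    generalize (a :: l).length = N at *
    have hl := congrArg List.length hsq
    simp only [List.length_take, List.length_drop, hlen] at hl
    have hN : 0 < N / 2 := by omega
    have e1 : w.take (N / 2) ++ w.take (N / 2) = w := by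
      conv_rhs => rw [← List.take_append_drop (N / 2) w]
      rw [← hsq]
    have h1 : (w.take (N / 2)).length = N / 2 := by
      rw [List.length_take, hlen]; omega
    refine ⟨w.take (N / 2), w.take (N / 2), ?_, ?_, List.prefix_append _ _, ?_⟩
    · intro h0
      rw [h0] at h1
      simp at h1
      omega
    · rw [e1]
    · rw [h1]
      have : (0 : ℝ) < ((N / 2 : ℕ) : ℝ) := by exact_mod_cast hN
      rw [le_div_iff₀ this]
      linarith
end

section
/- Let C be the finite caterpillar with vertices u₀,…,u₅ and v₀,…,v₅, where uᵢ is adjacent to uᵢ₊₁ for 0 ≤ i ≤ 4 and uᵢ is adjacent to vᵢ for 0 ≤ i ≤ 5. Every 4-coloring of C contains a factor that is a repetition of exponent at least 3/2. -/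
open SimpleGraph

/-- The finite caterpillar with backbone `u₀, …, u₅` (the vertices `(i, false)`) and a pendant
vertex `vᵢ = (i, true)` attached to `uᵢ` for each `0 ≤ i ≤ 5`. -/
def Caterpillar6 : SimpleGraph (Fin 6 × Bool) :=
  SimpleGraph.fromRel (fun a b =>
    (a.2 = false ∧ b.2 = false ∧ (b.1 : ℕ) = (a.1 : ℕ) + 1) ∨
    (a.2 = false ∧ b.2 = true ∧ a.1 = b.1))

/-- Adjacency in the caterpillar is decidable. -/
instance caterpillarDec : DecidableRel Caterpillar6.Adj := fun a b => by
  unfold Caterpillar6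
  simp only [SimpleGraph.fromRel_adj]
  infer_instance

/-- A path given by its list of vertices, whose last `k` colors agree with its first `k`
colors, gives a repetition. -/
theorem rep_of_list (c : Fin 6 × Bool → Fin 4) (l : List (Fin 6 × Bool)) (k : ℕ)
    (h : l ≠ [] ∧ l.IsChain Caterpillar6.Adj ∧ l.Nodup ∧ k < l.length ∧
      3 * (l.length - k) ≤ 2 * l.length)
    (hc : (l.map c).drop (l.length - k) = (l.map c).take k) :
    ColoringHasRepGE Caterpillar6 c (3 / 2) := by
  obtain ⟨hne, hch, hnd, hk, hle⟩ := h
  refine ⟨_, _, Walk.ofSupport l hne hch, ?_, ?_⟩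
  · rw [Walk.isPath_def, Walk.support_ofSupport]
    exact hnd
  · rw [Walk.support_ofSupport]
    refine ⟨(l.map c).take (l.length - k), (l.map c).drop (l.length - k), ?_, ?_, ?_, ?_⟩
    · intro h0
      have := congrArg List.length h0
      simp at this
      omega
    · rw [List.take_append_drop]
    · rw [List.take_append_drop, hc]
      exact List.take_prefix _ _
    · have h1 : ((l.map c).take (l.length - k)).length = l.length - k := by simp
      have h2 : ((l.map c).drop (l.length - k)).length = k := by simp; omega
      rw [h1, h2]
      have h3 : (0 : ℝ) < ((l.length - k : ℕ) : ℝ) := by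
        exact_mod_cast (by omega : 0 < l.length - k)
      rw [le_div_iff₀ h3]
      have h4 : 3 * (l.length - k) ≤ 2 * ((l.length - k) + k) := by omega
      have h5 : (3 : ℝ) * ((l.length - k : ℕ) : ℝ) ≤ 2 * (((l.length - k : ℕ) : ℝ) + (k : ℝ)) := by
        exact_mod_cast h4
      linarith

set_option synthInstance.maxSize 100000 in
set_option synthInstance.maxHeartbeats 1000000 in
set_option maxRecDepth 10000 in
/-- The finite search: `a i` are the colors of the backbone, `x, y, z` those of the first three
pendant vertices. -/
theorem search : ∀ a0 a1 : Fin 4, a0 ≠ a1 → ∀ a2, a1 ≠ a2 → a0 ≠ a2 →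
    ∀ a3, a2 ≠ a3 → a1 ≠ a3 → ∀ a4, a3 ≠ a4 → a2 ≠ a4 → ¬ (a3 = a0 ∧ a4 = a1) →
    ∀ a5, a4 ≠ a5 → a3 ≠ a5 → ¬ (a4 = a1 ∧ a5 = a2) → ¬ (a4 = a0 ∧ a5 = a1) →
    ∀ x, a0 ≠ x → x ≠ a1 → ¬ (a2 = x ∧ a3 = a0) → ¬ (a3 = x ∧ a4 = a0) →
    ∀ y, a1 ≠ y → a0 ≠ y → y ≠ a2 → ¬ (a3 = y ∧ a4 = a1) → ¬ (a4 = y ∧ a5 = a1) →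
    ∀ z, a2 ≠ z → a1 ≠ z → z ≠ a3 → ¬ (a2 = x ∧ z = a0) → ¬ (a4 = z ∧ a5 = a2) → False := by
  decide +kernel

/-- Every 4-coloring of the caterpillar `C` contains a factor that is a repetition of
exponent at least 3/2. -/
theorem caterpillar6_four_coloring_hasRep (c : Fin 6 × Bool → Fin 4) :
    ColoringHasRepGE Caterpillar6 c (3 / 2) := by
  by_contra hno
  have key := fun l k h hc => hno (rep_of_list c l k h hc)
  refine search (c (0, false)) (c (1, false)) ?_ (c (2, false)) ?_ ?_ (c (3, false)) ?_ ?_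
    (c (4, false)) ?_ ?_ ?_ (c (5, false)) ?_ ?_ ?_ ?_ (c (0, true)) ?_ ?_ ?_ ?_
    (c (1, true)) ?_ ?_ ?_ ?_ ?_ (c (2, true)) ?_ ?_ ?_ ?_ ?_ <;> intro h
  · exact key [(0, false), (1, false)] 1 (by decide) (by simp [h])
  · exact key [(1, false), (2, false)] 1 (by decide) (by simp [h])
  · exact key [(0, false), (1, false), (2, false)] 1 (by decide) (by simp [h])
  · exact key [(2, false), (3, false)] 1 (by decide) (by simp [h])
  · exact key [(1, false), (2, false), (3, false)] 1 (by decide) (by simp [h])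
  · exact key [(3, false), (4, false)] 1 (by decide) (by simp [h])
  · exact key [(2, false), (3, false), (4, false)] 1 (by decide) (by simp [h])
  · exact key [(0, false), (1, false), (2, false), (3, false), (4, false)] 2
      (by decide) (by simp [h])
  · exact key [(4, false), (5, false)] 1 (by decide) (by simp [h])
  · exact key [(3, false), (4, false), (5, false)] 1 (by decide) (by simp [h])
  · exact key [(1, false), (2, false), (3, false), (4, false), (5, false)] 2
      (by decide) (by simp [h])
  · exact key [(0, false), (1, false), (2, false), (3, false), (4, false), (5, false)] 2
      (by decide) (by simp [h])
  · exact key [(0, false), (0, true)] 1 (by decide) (by simp [h])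
  · exact key [(0, true), (0, false), (1, false)] 1 (by decide) (by simp [h])
  · exact key [(0, true), (0, false), (1, false), (2, false), (3, false)] 2
      (by decide) (by simp [h])
  · exact key [(0, true), (0, false), (1, false), (2, false), (3, false), (4, false)] 2
      (by decide) (by simp [h])
  · exact key [(1, false), (1, true)] 1 (by decide) (by simp [h])
  · exact key [(0, false), (1, false), (1, true)] 1 (by decide) (by simp [h])
  · exact key [(1, true), (1, false), (2, false)] 1 (by decide) (by simp [h])
  · exact key [(1, true), (1, false), (2, false), (3, false), (4, false)] 2
      (by decide) (by simp [h])
  · exact key [(1, true), (1, false), (2, false), (3, false), (4, false), (5, false)] 2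
      (by decide) (by simp [h])
  · exact key [(2, false), (2, true)] 1 (by decide) (by simp [h])
  · exact key [(1, false), (2, false), (2, true)] 1 (by decide) (by simp [h])
  · exact key [(2, true), (2, false), (3, false)] 1 (by decide) (by simp [h])
  · exact key [(0, true), (0, false), (1, false), (2, false), (2, true)] 2
      (by decide) (by simp [h])
  · exact key [(2, true), (2, false), (3, false), (4, false), (5, false)] 2
      (by decide) (by simp [h])
end

section
/- For every integer k ≥ 5, every k-coloring of the infinite caterpillar of maximum degree 3 contains a factor that is a repetition of exponent at least 1 + 1/⌈k/2⌉. -/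
open SimpleGraph

theorem cat_adj (a b : ℤ × Bool) : InfCaterpillar.Adj a b ↔
    (a.2 = false ∧ b.2 = false ∧ (b.1 = a.1 + 1 ∨ a.1 = b.1 + 1)) ∨
    (a.2 ≠ b.2 ∧ a.1 = b.1) := by
  obtain ⟨a, x⟩ := a
  obtain ⟨b, y⟩ := b
  cases x <;> cases y <;> simp [InfCaterpillar, SimpleGraph.fromRel_adj]
  all_goals omega

theorem exists_walk_of_fun {V : Type*} (G : SimpleGraph V) (n : ℕ) : ∀ (f : ℕ → V),
    (∀ i < n, G.Adj (f i) (f (i + 1))) →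
    ∃ p : G.Walk (f 0) (f n), p.support = (List.range (n + 1)).map f := by
  induction n with
  | zero => intro f _; exact ⟨Walk.nil, by simp⟩
  | succ n ih =>
    intro f h
    obtain ⟨p, hp⟩ := ih (fun i => f (i + 1)) (fun i hi => h (i + 1) (by omega))
    refine ⟨Walk.cons (h 0 (by omega)) p, ?_⟩
    rw [Walk.support_cons, hp, List.range_succ_eq_map (n := n + 1)]
    simp [Function.comp_def]

theorem rep_of_fun {V α : Type*} (G : SimpleGraph V) (c : V → α) (m d r : ℕ) (hm : 1 ≤ m)
    (hd : 1 ≤ d) (hr : 1 ≤ r) (hdr : d ≤ m * r) (f : ℕ → V)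
    (hadj : ∀ i, i + 1 < d + r → G.Adj (f i) (f (i + 1)))
    (hinj : ∀ i j, i < j → j < d + r → f i ≠ f j)
    (hrep : ∀ j < r, c (f j) = c (f (d + j))) :
    ColoringHasRepGE G c (1 + 1 / (m : ℝ)) := by
  obtain ⟨p, hp⟩ := exists_walk_of_fun G (d + r - 1) f (fun i hi => hadj i (by omega))
  rw [show d + r - 1 + 1 = d + r by omega] at hp
  refine ⟨_, _, p, ?_, (List.range d).map (c ∘ f), (List.range r).map (c ∘ f), ?_, ?_, ?_, ?_⟩
  · rw [Walk.isPath_def, hp]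
    refine List.Nodup.map_on ?_ List.nodup_range
    intro x hx y hy hxy
    rw [List.mem_range] at hx hy
    rcases lt_trichotomy x y with h | h | h
    · exact absurd hxy (hinj x y h hy)
    · exact h
    · exact absurd hxy.symm (hinj y x h hx)
  · simp; omega
  · have : (List.range d).map (c ∘ f) ++ (List.range r).map (c ∘ f) = p.support.map c := by
      rw [hp, List.range_add]
      simp only [List.map_append, List.map_map]
      congr 1
      apply List.map_congr_left
      intro j hj
      simpa using hrep j (by simpa using hj)
    rw [this]
  · have : (List.range d).map (c ∘ f) ++ (List.range r).map (c ∘ f)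
        = (List.range (r + d)).map (c ∘ f) := by
      rw [add_comm, List.range_add]
      simp only [List.map_append, List.map_map]
      congr 1
      apply List.map_congr_left
      intro j hj
      simpa using hrep j (by simpa using hj)
    rw [this, List.range_add, List.map_append]
    exact List.prefix_append _ _
  · simp only [List.length_map, List.length_range]
    have h1 : (0 : ℝ) < m := by exact_mod_cast hm
    have h2 : (0 : ℝ) < d := by exact_mod_cast hd
    have h3 : (d : ℝ) ≤ m * r := by exact_mod_cast hdr
    rw [add_div, div_self h2.ne']
    gcongr 1 + ?_
    rw [div_le_div_iff₀ h1 h2]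
    linarith

theorem infCaterpillar_k_coloring_hasRep (k : ℕ) (hk : 5 ≤ k) (c : ℤ × Bool → Fin k) :
    ColoringHasRepGE InfCaterpillar c (1 + 1 / (((k + 1) / 2 : ℕ) : ℝ)) := by
  obtain ⟨m, hmdef⟩ : ∃ m, m = (k + 1) / 2 := ⟨_, rfl⟩
  rw [← hmdef]
  have hm : 3 ≤ m := by omega
  have hk2 : k ≤ 2 * m := by omega
  by_contra hno
  -- repetitions read along a spine segment
  have spine : ∀ (a : ℤ) (d r : ℕ), 1 ≤ d → 1 ≤ r → d ≤ m * r →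
      ¬ ∀ j < r, c (a + j, false) = c (a + d + j, false) := by
    intro a d r hd hr hdr hrep
    refine hno (rep_of_fun _ c m d r (by omega) hd hr hdr (fun j => (a + j, false)) ?_ ?_ ?_)
    · intro i hi
      rw [cat_adj]
      left; refine ⟨rfl, rfl, Or.inl ?_⟩
      push_cast; ring
    · intro i j hij hj h
      simp at h; omega
    · intro j hj
      have := hrep j hj
      simpa [add_assoc] using this
  -- repetitions starting at a leaf
  have leafs : ∀ (a : ℤ) (d r : ℕ), 1 ≤ d → 1 ≤ r → d ≤ m * r →
      c (a, true) = c (a + d - 1, false) →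
      ¬ ∀ j < r, 1 ≤ j → c (a + j - 1, false) = c (a + d + j - 1, false) := by
    intro a d r hd hr hdr h0 hrep
    refine hno (rep_of_fun _ c m d r (by omega) hd hr hdr
      (fun j => if j = 0 then (a, true) else (a + j - 1, false)) ?_ ?_ ?_)
    · intro i hi
      rw [cat_adj]
      rcases Nat.eq_zero_or_pos i with rfl | h
      · right; simp
      · left
        simp [h.ne']
        omega
    · intro i j hij hj h
      have hj0 : j ≠ 0 := by omega
      by_cases hi0 : i = 0
      · simp [hi0, hj0] at h
      · simp [hi0, hj0] at h; omega
    · intro j hj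
      have hd0 : d ≠ 0 := by omega
      by_cases hj0 : j = 0
      · simpa [hj0, hd0] using h0
      · have := hrep j hj (by omega)
        simp [hj0, hd0]
        rw [this]; congr 2; ring
  have SS : ∀ a b : ℤ, a < b → b ≤ a + m → c (a, false) ≠ c (b, false) := by
    intro a b h1 h2 h
    obtain ⟨d, rfl⟩ : ∃ d : ℕ, b = a + d := ⟨(b - a).toNat, by omega⟩
    refine spine a d 1 (by omega) le_rfl (by omega) ?_
    intro j hj
    obtain rfl : j = 0 := by omega
    simpa using h
  have LS : ∀ a b : ℤ, a ≤ b → b + 1 ≤ a + m → c (a, true) ≠ c (b, false) := by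
    intro a b h1 h2 h
    obtain ⟨d, rfl⟩ : ∃ d : ℕ, b = a + d := ⟨(b - a).toNat, by omega⟩
    refine leafs a (d + 1) 1 (by omega) le_rfl (by omega) ?_ ?_
    · rw [h]; congr 2; push_cast; ring
    · intro j hj hj'; omega
  have SL : ∀ a b : ℤ, a ≤ b → b + 1 ≤ a + m → c (a, false) ≠ c (b, true) := by
    intro a b h1 h2 h
    refine hno (rep_of_fun _ c m ((b - a).toNat + 1) 1 (by omega) (by omega) le_rfl (by omega)
      (fun j => if j = 0 then (b, true) else (b - j + 1, false)) ?_ ?_ ?_)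
    · intro i hi
      rw [cat_adj]
      rcases Nat.eq_zero_or_pos i with rfl | h
      · right; simp
      · left
        simp [h.ne']
        omega
    · intro i j hij hj h
      have hj0 : j ≠ 0 := by omega
      by_cases hi0 : i = 0
      · simp [hi0, hj0] at h
      · simp [hi0, hj0] at h; omega
    · intro j hj
      obtain rfl : j = 0 := by omega
      simp only [if_true, add_zero, Nat.succ_ne_zero, if_false]
      rw [← h]; congr 2; omega
  have LL : ∀ a b : ℤ, a < b → b + 2 ≤ a + m → c (a, true) ≠ c (b, true) := by
    intro a b h1 h2 h
    obtain ⟨d, rfl⟩ : ∃ d : ℕ, b = a + d := ⟨(b - a).toNat, by omega⟩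
    refine hno (rep_of_fun _ c m (d + 2) 1 (by omega) (by omega) le_rfl (by omega)
      (fun j => if j = 0 then (a, true) else if j = d + 2 then (a + d, true)
        else (a + j - 1, false)) ?_ ?_ ?_)
    · intro i hi
      rw [cat_adj]
      rcases Nat.eq_zero_or_pos i with rfl | h
      · right; simp
      · have h3 : i ≠ d + 2 := by omega
        by_cases h4 : i = d + 1
        · right
          simp [h4]
          omega
        · left
          have h5 : i + 1 ≠ d + 2 := by omega
          simp [h.ne', h3, h4]
          omega
    · intro i j hij hj h
      have hj0 : j ≠ 0 := by omega
      have hi2 : i ≠ d + 2 := by omega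
      by_cases hi0 : i = 0 <;> by_cases hj2 : j = d + 2 <;>
        simp [hi0, hj0, hi2, hj2] at h <;> omega
    · intro j hj
      obtain rfl : j = 0 := by omega
      simpa using h
  -- the window of `2m` vertices sees every colour
  have win : ∀ (i : ℤ) (x : Fin k), (∃ j : ℤ, i ≤ j ∧ j ≤ i + m ∧ c (j, false) = x) ∨
      (∃ j : ℤ, i + 1 ≤ j ∧ j + 1 ≤ i + m ∧ c (j, true) = x) := by
    intro i x
    let W : Fin (m + 1) ⊕ Fin (m - 1) → Fin k :=
      Sum.elim (fun j => c (i + (j : ℕ), false)) (fun j => c (i + 1 + (j : ℕ), true))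
    have hSL : ∀ (a : Fin (m + 1)) (b : Fin (m - 1)),
        c (i + (a : ℕ), false) ≠ c (i + 1 + (b : ℕ), true) := by
      intro a b
      have := a.2
      have := b.2
      by_cases hab : i + (a : ℕ) ≤ i + 1 + (b : ℕ)
      · exact SL _ _ hab (by omega)
      · exact (LS _ _ (by omega) (by omega)).symm
    have hinj : Function.Injective W := by
      rintro (a | a) (b | b) h
      · have := a.2
        have := b.2
        rcases lt_trichotomy (a : ℕ) (b : ℕ) with h' | h' | h'
        · exact absurd h (SS _ _ (by omega) (by omega))
        · rw [Fin.ext h']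
        · exact absurd h.symm (SS _ _ (by omega) (by omega))
      · exact absurd h (hSL a b)
      · exact absurd h.symm (hSL b a)
      · have := a.2
        have := b.2
        rcases lt_trichotomy (a : ℕ) (b : ℕ) with h' | h' | h'
        · exact absurd h (LL _ _ (by omega) (by omega))
        · rw [Fin.ext h']
        · exact absurd h.symm (LL _ _ (by omega) (by omega))
    have hcard := Fintype.card_le_of_injective W hinj
    have hbij := (Fintype.bijective_iff_injective_and_card W).2 ⟨hinj, by
      simp at hcard ⊢; omega⟩
    obtain ⟨y, hy⟩ := hbij.2 x
    rcases y with a | a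
    · have := a.2
      exact Or.inl ⟨_, by omega, by omega, hy⟩
    · have := a.2
      exact Or.inr ⟨_, by omega, by omega, hy⟩
  have nextS : ∀ i : ℤ, c (i + m + 1, false) = c (i, false) ∨
      c (i + m + 1, false) = c (i + 1, true) := by
    intro i
    rcases win i (c (i + m + 1, false)) with ⟨j, h1, h2, h3⟩ | ⟨j, h1, h2, h3⟩
    · by_cases hj : j = i
      · left; rw [← h3, hj]
      · exact absurd h3 (SS _ _ (by omega) (by omega))
    · by_cases hj : j = i + 1
      · right; rw [← h3, hj]
      · exact absurd h3 (LS _ _ (by omega) (by omega))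
  have nextL : ∀ i : ℤ, c (i + m, true) = c (i, false) ∨
      c (i + m, true) = c (i + 1, true) := by
    intro i
    rcases win i (c (i + m, true)) with ⟨j, h1, h2, h3⟩ | ⟨j, h1, h2, h3⟩
    · by_cases hj : j = i
      · left; rw [← h3, hj]
      · exact absurd h3 (SL _ _ (by omega) (by omega))
    · by_cases hj : j = i + 1
      · right; rw [← h3, hj]
      · exact absurd h3 (LL _ _ (by omega) (by omega))
  -- the spine colour is never kept
  have no0 : ∀ i : ℤ, c (i + m + 1, false) ≠ c (i, false) := by
    intro i h
    rcases nextS (i - 1) with h' | h'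
    · refine spine (i - 1) (m + 1) 2 (by omega) (by omega) (by omega) ?_
      intro j hj
      obtain rfl | rfl : j = 0 ∨ j = 1 := by omega
      · rw [show i - 1 + ((m + 1 : ℕ) : ℤ) + ((0 : ℕ) : ℤ) = i - 1 + m + 1 by push_cast; ring, h']
        simp
      · rw [show i - 1 + ((m + 1 : ℕ) : ℤ) + ((1 : ℕ) : ℤ) = i + m + 1 by push_cast; ring, h]
        simp
    · rw [show i - 1 + 1 = i by ring, show i - 1 + (m : ℤ) + 1 = i + m by ring] at h'
      refine leafs i (m + 1) 2 (by omega) (by omega) (by omega) ?_ ?_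
      · rw [show i + ((m + 1 : ℕ) : ℤ) - 1 = i + m by push_cast; ring, h']
      · intro j hj hj'
        obtain rfl : j = 1 := by omega
        rw [show i + ((m + 1 : ℕ) : ℤ) + ((1 : ℕ) : ℤ) - 1 = i + m + 1 by push_cast; ring, h]
        simp
  have S1 : ∀ i : ℤ, c (i + m, false) = c (i, true) := by
    intro i
    have h := (nextS (i - 1)).resolve_left (no0 _)
    rwa [show i - 1 + 1 = i by ring, show i - 1 + (m : ℤ) + 1 = i + m by ring] at h
  have L1 : ∀ i : ℤ, c (i + m, true) = c (i, false) := by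
    intro i
    refine (nextL i).resolve_right ?_
    intro h
    rw [← S1 (i + 1)] at h
    exact LS (i + m) (i + 1 + m) (by omega) (by omega) h
  refine spine 0 (2 * m) 2 (by omega) (by omega) (by omega) ?_
  intro j hj
  rw [show (0 : ℤ) + ((2 * m : ℕ) : ℤ) + (j : ℤ) = (0 + j + m) + m by push_cast; ring, S1, L1]
end

section
/- The infinite caterpillar of maximum degree 3 admits a 5-coloring that is (4/3)⁺-free, i.e., a coloring with 5 colors in which no factor contains a repetition of exponent strictly greater than 4/3. -/
open SimpleGraph

namespace Cat

/-- The two permutations of the five colours (identity outside `0..4`). -/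
def pi : Bool → ℕ → ℕ
  | false, 0 => 0
  | false, 1 => 2
  | false, 2 => 3
  | false, 3 => 4
  | false, 4 => 1
  | true, 0 => 1
  | true, 1 => 2
  | true, 2 => 3
  | true, 3 => 4
  | true, 4 => 0
  | _, (n + 5) => n + 5

def piInv : Bool → ℕ → ℕ
  | false, 0 => 0
  | false, 2 => 1
  | false, 3 => 2
  | false, 4 => 3
  | false, 1 => 4
  | true, 1 => 0
  | true, 2 => 1
  | true, 3 => 2
  | true, 4 => 3
  | true, 0 => 4
  | _, (n + 5) => n + 5

theorem piInv_pi : ∀ b x, piInv b (pi b x) = x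
  | false, 0 => rfl
  | false, 1 => rfl
  | false, 2 => rfl
  | false, 3 => rfl
  | false, 4 => rfl
  | true, 0 => rfl
  | true, 1 => rfl
  | true, 2 => rfl
  | true, 3 => rfl
  | true, 4 => rfl
  | true, (_ + 5) => rfl
  | false, (_ + 5) => rfl

theorem pi_ge (b : Bool) (n : ℕ) (h : 5 ≤ n) : pi b n = n := by
  obtain ⟨k, rfl⟩ := Nat.exists_eq_add_of_le' h
  cases b <;> rfl

theorem pi_lt (b : Bool) (n : ℕ) (h : n < 5) : pi b n < 5 := by
  cases b <;> interval_cases n <;> decide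

theorem pi_inj (b : Bool) {x y : ℕ} (h : pi b x = pi b y) : x = y := by
  have := congrArg (piInv b) h
  rwa [piInv_pi, piInv_pi] at this

/-- Walk along a sequence of permutations. -/
def wk (f : ℕ → Bool) : ℕ → ℕ → ℕ
  | 0, x => x
  | k + 1, x => wk f k (pi (f k) x)

theorem wk_add (f : ℕ → Bool) (n k x : ℕ) :
    wk f (n + k) x = wk f n (wk (fun t => f (n + t)) k x) := by
  induction k generalizing x with
  | zero => rfl
  | succ k ih => exact ih _

theorem wk_congr {f g : ℕ → Bool} (k x : ℕ) (h : ∀ t < k, f t = g t) : wk f k x = wk g k x := by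
  induction k generalizing x with
  | zero => rfl
  | succ k ih =>
    show wk f k _ = wk g k _
    rw [h k (by omega), ih _ (fun t ht => h t (by omega))]

theorem wk_inj (f : ℕ → Bool) (k : ℕ) {x y : ℕ} (h : wk f k x = wk f k y) : x = y := by
  induction k generalizing x y with
  | zero => exact h
  | succ k ih => exact pi_inj _ (ih h)

theorem wk_lt (f : ℕ → Bool) (k : ℕ) {x : ℕ} (h : x < 5) : wk f k x < 5 := by
  induction k generalizing x with
  | zero => exact h
  | succ k ih => exact ih (pi_lt _ _ h)

theorem wk_ge (f : ℕ → Bool) (k : ℕ) {x : ℕ} (h : 5 ≤ x) : wk f k x = x := by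
  induction k generalizing x with
  | zero => rfl
  | succ k ih =>
    show wk f k _ = x
    rw [pi_ge _ _ h, ih h]

/-- The Toeplitz code of period 14. -/
def code (n : ℕ) : Bool :=
  if n % 14 = 13 then code (n / 14) else Nat.testBit 3737 (n % 14)
termination_by n
decreasing_by omega

theorem code_hole (j : ℕ) : code (14 * j + 13) = code j := by
  rw [code, if_pos (by omega)]
  congr 1
  omega

theorem code_fix (j r : ℕ) (h : r < 13) : code (14 * j + r) = Nat.testBit 3737 r := by
  rw [code, if_neg (by omega)]
  congr 1
  omega

def W : ℕ → ℕ → ℕ := wk code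

theorem W_add (n k x : ℕ) : W (n + k) x = W n (wk (fun t => code (n + t)) k x) := wk_add _ _ _ _

theorem W_inj (n : ℕ) {x y : ℕ} (h : W n x = W n y) : x = y := wk_inj _ _ h

theorem base_id : ∀ x < 5, wk (fun t => Nat.testBit 3737 t) 13 x = x := by decide +kernel

theorem W14 (j x : ℕ) : W (14 * j) x = W j x := by
  induction j generalizing x with
  | zero => rfl
  | succ j ih =>
    show W (14 * j + (13 + 1)) x = W j (pi (code j) x)
    rw [W_add, ih]
    congr 1
    show wk (fun t => code (14 * j + t)) 13 (pi (code (14 * j + 13)) x) = _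
    rw [code_hole, wk_congr 13 _ (g := fun t => Nat.testBit 3737 t)
      (fun t ht => code_fix j t ht)]
    by_cases hx : x < 5
    · exact base_id _ (pi_lt _ _ hx)
    · rw [pi_ge _ _ (by omega)]
      exact wk_ge _ _ (by omega)

theorem W14r (j r x : ℕ) (h : r < 14) :
    W (14 * j + r) x = W j (wk (fun t => Nat.testBit 3737 t) r x) := by
  rw [W_add, W14, wk_congr]
  intro t ht
  exact code_fix j t (by omega)

/-- code with prescribed hole bits -/
def fb (m s : ℕ) : Bool := if s % 14 = 13 then Nat.testBit m (s / 14) else Nat.testBit 3737 (s % 14)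

theorem checkW : ∀ m < 8, ∀ r < 14, ∀ p < 24, ∃ k < max 1 (p / 3), ∃ x < 5,
    wk (fb m) (r + k) x ≠ wk (fb m) (r + (p + 1) + k) x := by decide +kernel

theorem code_fb (j : ℕ) : ∃ m < 8, ∀ s < 55, code (14 * j + s) = fb m s := by
  obtain ⟨m, hm, h0, h1, h2⟩ : ∃ m < 8, Nat.testBit m 0 = code j ∧ Nat.testBit m 1 = code (j + 1) ∧
      Nat.testBit m 2 = code (j + 2) := by
    generalize code j = a
    generalize code (j + 1) = b
    generalize code (j + 2) = c
    revert a b c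
    decide
  refine ⟨m, hm, fun s hs => ?_⟩
  unfold fb
  split_ifs with h
  · have e : 14 * j + s = 14 * (j + s / 14) + 13 := by omega
    rw [e, code_hole]
    have : s / 14 < 3 := by omega
    interval_cases s / 14 <;> simp [*]
  · have e : 14 * j + s = 14 * (j + s / 14) + s % 14 := by omega
    rw [e, code_fix _ _ (by omega)]

theorem checkSync : ∀ x < 14, ∀ y < 14, x ≠ y → ∃ k < 7, (x + k) % 14 ≠ 13 ∧ (y + k) % 14 ≠ 13 ∧
    Nat.testBit 3737 ((x + k) % 14) ≠ Nat.testBit 3737 ((y + k) % 14) := by decide +kernel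

end Cat
namespace Cat

theorem W_small (p i : ℕ) (hp : 1 ≤ p) (hp24 : p ≤ 24)
    (h : ∀ k < max 1 ((p - 1) / 3), ∀ x, W (i + k) x = W (i + p + k) x) : False := by
  obtain ⟨m, hm, hc⟩ := code_fb (i / 14)
  obtain ⟨k, hk, x, -, hne⟩ := checkW m hm (i % 14) (by omega) (p - 1) (by omega)
  apply hne
  have key : ∀ t ≤ 55, W (14 * (i / 14) + t) x = W (14 * (i / 14)) (wk (fb m) t x) := by
    intro t ht
    rw [W_add, wk_congr]
    intro s hs
    exact hc s (by omega)
  have hk' : k < 8 := by omega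
  have h1 := h k hk x
  have e1 : i + k = 14 * (i / 14) + (i % 14 + k) := by omega
  have e2 : i + p + k = 14 * (i / 14) + (i % 14 + (p - 1 + 1) + k) := by omega
  rw [e1, e2, key _ (by omega), key _ (by omega)] at h1
  exact W_inj _ h1

theorem code_eq_of_W {a b : ℕ} (h0 : ∀ x, W a x = W b x) (h1 : ∀ x, W (a + 1) x = W (b + 1) x) :
    code a = code b := by
  have e := h1 0
  change W a (pi (code a) 0) = W b (pi (code b) 0) at e
  rw [h0] at e
  have e2 := W_inj _ e
  revert e2
  cases code a <;> cases code b <;> decide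

theorem pi_piInv : ∀ b x, pi b (piInv b x) = x
  | false, 0 => rfl
  | false, 1 => rfl
  | false, 2 => rfl
  | false, 3 => rfl
  | false, 4 => rfl
  | true, 0 => rfl
  | true, 1 => rfl
  | true, 2 => rfl
  | true, 3 => rfl
  | true, 4 => rfl
  | true, (_ + 5) => rfl
  | false, (_ + 5) => rfl

theorem wk_surj (f : ℕ → Bool) (k x : ℕ) : ∃ y, wk f k y = x := by
  induction k generalizing x with
  | zero => exact ⟨x, rfl⟩
  | succ k ih =>
    obtain ⟨y, hy⟩ := ih x
    exact ⟨piInv (f k) y, by rw [← hy]; exact congrArg (wk f k) (pi_piInv _ _)⟩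

theorem code_val (n : ℕ) (h : n % 14 ≠ 13) : code n = Nat.testBit 3737 (n % 14) := by
  rw [code, if_neg h]

theorem W_lemma (p : ℕ) : ∀ i, 1 ≤ p →
    (∀ k < max 1 ((p - 1) / 3), ∀ x, W (i + k) x = W (i + p + k) x) → False := by
  induction p using Nat.strong_induction_on with
  | _ p ih =>
  intro i hp h
  by_cases hp24 : p ≤ 24
  · exact W_small p i hp hp24 h
  have hmod : i % 14 = (i + p) % 14 := by
    by_contra hne
    obtain ⟨k, hk, h1, h2, h3⟩ := checkSync (i % 14) (by omega) ((i + p) % 14) (by omega) hne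
    apply h3
    have e1 : (i % 14 + k) % 14 = (i + k) % 14 := by omega
    have e2 : ((i + p) % 14 + k) % 14 = (i + p + k) % 14 := by omega
    rw [e1] at h1 ⊢
    rw [e2] at h2 ⊢
    rw [← code_val _ h1, ← code_val _ h2]
    exact code_eq_of_W (h k (by omega)) (h (k + 1) (by omega))
  obtain ⟨p', rfl⟩ : ∃ p', p = 14 * p' := ⟨p / 14, by omega⟩
  refine ih p' (by omega) (i / 14) (by omega) ?_
  intro k hk x
  obtain ⟨y, rfl⟩ := wk_surj (fun t => Nat.testBit 3737 t) (i % 14) x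
  rw [← W14r _ _ _ (by omega), ← W14r _ _ _ (by omega)]
  have h2 := h (14 * k) (by omega) y
  have e1 : i + 14 * k = 14 * (i / 14 + k) + i % 14 := by omega
  have e2 : i + 14 * p' + 14 * k = 14 * (i / 14 + p' + k) + i % 14 := by omega
  rwa [e1, e2] at h2

/-- digits in base 8 -/
def Bs : Bool → ℕ
  | false => 32597944804169352833
  | true => 32481196588485445249

def Bl : Bool → ℕ
  | false => 9223935021168235300
  | true => 2347027730350248740

def dg (t x : ℕ) : ℕ := t / 8 ^ x % 8

def cs (h : ℕ → Bool) (x : ℕ) : ℕ := wk h (x / 22) (dg (Bs (h (x / 22))) (x % 22))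
def cl (h : ℕ → Bool) (x : ℕ) : ℕ := wk h (x / 22) (dg (Bl (h (x / 22))) (x % 22))

theorem Bs_lt : ∀ b, ∀ x < 22, dg (Bs b) x < 5 := by decide +kernel
theorem Bl_lt : ∀ b, ∀ x < 22, dg (Bl b) x < 5 := by decide +kernel

theorem cs_lt (h : ℕ → Bool) (x : ℕ) : cs h x < 5 := wk_lt _ _ (Bs_lt _ _ (by omega))
theorem cl_lt (h : ℕ → Bool) (x : ℕ) : cl h x < 5 := wk_lt _ _ (Bl_lt _ _ (by omega))

/-- packing of a sequence of octal digits -/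
def pack (f : ℕ → ℕ) : ℕ → ℕ
  | 0 => 0
  | n + 1 => f 0 + 8 * pack (fun k => f (k + 1)) n

theorem dg_pack (n : ℕ) : ∀ (f : ℕ → ℕ) (_ : ∀ k, f k < 5) (x : ℕ), x < n → dg (pack f n) x = f x := by
  induction n with
  | zero => intro f _ x hx; omega
  | succ n ih =>
    intro f hf x hx
    have h0 := hf 0
    cases x with
    | zero => simp only [dg, pack]; omega
    | succ x =>
      have := ih (fun k => f (k + 1)) (fun k => hf _) x (by omega)
      rw [← this]
      unfold dg
      rw [pow_succ', ← Nat.div_div_eq_div_mul]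
      congr 2
      simp only [pack]
      omega

def run (N i p q : ℕ) : Bool := Nat.beq (N / 8 ^ i % 8 ^ q) (N / 8 ^ (i + p) % 8 ^ q)

theorem run_of (N p q : ℕ) : ∀ i, (∀ k < q, dg N (i + k) = dg N (i + p + k)) → run N i p q = true := by
  induction q with
  | zero => intro i _; simp [run, Nat.mod_one]
  | succ q ih =>
    intro i h
    have h1 := ih (i + 1) (fun k hk => by
      have := h (k + 1) (by omega)
      convert this using 2 <;> omega)
    have h0 := h 0 (by omega)
    unfold run dg at *
    rw [Nat.beq_eq] at h1 ⊢
    rw [add_zero, add_zero] at h0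
    rw [pow_succ', Nat.mod_mul, Nat.mod_mul, h0]
    rw [Nat.div_div_eq_div_mul, Nat.div_div_eq_div_mul, ← pow_succ, ← pow_succ, h1]
    have e : i + 1 + p = i + p + 1 := by omega
    rw [e]

/-- a bad configuration of period `p` at `i` -/
def badB (N M i p q : ℕ) : Bool :=
  run N i p (q - 1) &&
   ((run N i p (q + 1)) ||
   (Nat.beq (dg M i) (dg N (i + p - 1)) && run N i p q) ||
   (run N i p q && Nat.beq (dg N (i + q)) (dg M (i + p + q - 1))) ||
   (Nat.ble 1 q && Nat.beq (dg M i) (dg N (i + p - 1)) && run N i p (q - 1) &&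
     Nat.beq (dg N (i + q - 1)) (dg M (i + p + q - 2))))

def allB : ℕ → (ℕ → Bool) → Bool
  | 0, _ => true
  | n + 1, f => f n && allB n f

theorem allB_spec (n : ℕ) (f : ℕ → Bool) (h : allB n f = true) : ∀ k < n, f k = true := by
  induction n with
  | zero => intro k hk; omega
  | succ n ih =>
    intro k hk
    simp only [allB, Bool.and_eq_true] at h
    rcases Nat.lt_succ_iff_lt_or_eq.1 hk with h' | h'
    · exact ih h.2 k h'
    · rw [h']; exact h.1

/-- checks periods `lo + 1, ..., lo + n` -/
def checkNM (lo n N M : ℕ) : Bool :=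
  allB n fun p => allB 22 fun i => !(badB N M i (lo + p + 1) ((lo + p + 1) / 3))

/-- forces the evaluation of the packed numbers -/
def force (lo n N M : ℕ) : Bool :=
  match N with
  | 0 => false
  | N' + 1 => match M with
    | 0 => false
    | M' + 1 => checkNM lo n (N' + 1) (M' + 1)

theorem force_spec {lo n N M : ℕ} (h : force lo n N M = true) : checkNM lo n N M = true := by
  unfold force at h
  split at h
  · cases h
  · split at h
    · cases h
    · exact h

/-- checks all contexts of `L` letters for the periods `lo + 1, ..., lo + n` -/
def checkL (L lo n : ℕ) : Bool :=
  allB (2 ^ L) fun m => force lo n (pack (cs (Nat.testBit m)) (22 * L))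
    (pack (cl (Nat.testBit m)) (22 * L))

set_option maxRecDepth 10000 in
theorem check2 : checkL 2 0 16 = true := by decide +kernel
theorem check3 : checkL 3 16 17 = true := by decide +kernel
theorem check4 : checkL 4 33 16 = true := by decide +kernel
theorem check5 : checkL 5 49 17 = true := by decide +kernel
theorem check6 : checkL 6 66 11 = true := by decide +kernel

end Cat
namespace Cat

/-- Bad configuration: a repetition of period `p` (of exponent larger than 4/3) along a path;
`f` are the colours of the spine and `g` those of the leaves. -/
def Bad {α : Type} (f g : ℕ → α) (p : ℕ) : Prop :=
  (∀ k < p / 3 + 1, f k = f (p + k)) ∨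
  (g 0 = f (p - 1) ∧ ∀ k < p / 3, f k = f (p + k)) ∨
  ((∀ k < p / 3, f k = f (p + k)) ∧ f (p / 3) = g (p + p / 3 - 1)) ∨
  (1 ≤ p / 3 ∧ g 0 = f (p - 1) ∧ (∀ k < p / 3 - 1, f k = f (p + k)) ∧
    f (p / 3 - 1) = g (p + p / 3 - 2))

theorem Bad.of {α β : Type} {f g : ℕ → α} {f' g' : ℕ → β} {p : ℕ}
    (hf : ∀ a ≤ p + p / 3, ∀ b ≤ p + p / 3, f a = f b → f' a = f' b)
    (hg : ∀ a ≤ p + p / 3, ∀ b ≤ p + p / 3, f a = g b → f' a = g' b)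
    (h : Bad f g p) : Bad f' g' p := by
  rcases h with h | ⟨h1, h2⟩ | ⟨h1, h2⟩ | ⟨h0, h1, h2, h3⟩
  · exact Or.inl fun k hk => hf _ (by omega) _ (by omega) (h k hk)
  · exact Or.inr (Or.inl ⟨(hg _ (by omega) _ (by omega) h1.symm).symm,
      fun k hk => hf _ (by omega) _ (by omega) (h2 k hk)⟩)
  · exact Or.inr (Or.inr (Or.inl ⟨fun k hk => hf _ (by omega) _ (by omega) (h1 k hk),
      hg _ (by omega) _ (by omega) h2⟩))
  · exact Or.inr (Or.inr (Or.inr ⟨h0, (hg _ (by omega) _ (by omega) h1.symm).symm,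
      fun k hk => hf _ (by omega) _ (by omega) (h2 k hk), hg _ (by omega) _ (by omega) h3⟩))

theorem Bad.run {α : Type} {f g : ℕ → α} {p : ℕ} (h : Bad f g p) :
    ∀ k < p / 3 - 1, f k = f (p + k) := by
  intro k hk
  rcases h with h | ⟨h1, h2⟩ | ⟨h1, h2⟩ | ⟨h0, h1, h2, h3⟩
  · exact h k (by omega)
  · exact h2 k (by omega)
  · exact h1 k (by omega)
  · exact h2 k hk

theorem badB_of {N M i p : ℕ} (hp : 1 ≤ p)
    (h : Bad (fun k => dg N (i + k)) (fun k => dg M (i + k)) p) :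
    badB N M i p (p / 3) = true := by
  have conv : ∀ e, (∀ k < e, dg N (i + k) = dg N (i + (p + k))) → run N i p e = true := by
    intro e he
    apply run_of
    intro k hk
    rw [add_assoc]
    exact he k hk
  have h0 := conv _ h.run
  have e1 : i + p - 1 = i + (p - 1) := by omega
  have e2 : i + p + p / 3 - 1 = i + (p + p / 3 - 1) := by omega
  unfold badB
  rw [h0, e1, e2]
  simp only [Bool.true_and, Bool.or_eq_true, Bool.and_eq_true, Nat.beq_eq, Nat.ble_eq]
  rcases h with h | ⟨h1, h2⟩ | ⟨h1, h2⟩ | ⟨h0, h1, h2, h3⟩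
  · exact Or.inl (Or.inl (Or.inl (conv _ h)))
  · exact Or.inl (Or.inl (Or.inr ⟨h1, conv _ h2⟩))
  · exact Or.inl (Or.inr ⟨conv _ h1, h2⟩)
  · refine Or.inr ⟨⟨⟨h0, h1⟩, trivial⟩, ?_⟩
    have e3 : i + p / 3 - 1 = i + (p / 3 - 1) := by omega
    have e4 : i + p + p / 3 - 2 = i + (p + p / 3 - 2) := by omega
    rw [e3, e4]
    exact h3

def S (n : ℕ) : ℕ := W (n / 22) (dg (Bs (code (n / 22))) (n % 22))
def Lf (n : ℕ) : ℕ := W (n / 22) (dg (Bl (code (n / 22))) (n % 22))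

theorem S_lt (n : ℕ) : S n < 5 := wk_lt _ _ (Bs_lt _ _ (by omega))
theorem Lf_lt (n : ℕ) : Lf n < 5 := wk_lt _ _ (Bl_lt _ _ (by omega))

theorem S_cs (j x : ℕ) : S (22 * j + x) = W j (cs (fun t => code (j + t)) x) := by
  have e1 : (22 * j + x) / 22 = j + x / 22 := by omega
  have e2 : (22 * j + x) % 22 = x % 22 := by omega
  unfold S cs
  rw [e1, e2, W_add]

theorem Lf_cl (j x : ℕ) : Lf (22 * j + x) = W j (cl (fun t => code (j + t)) x) := by
  have e1 : (22 * j + x) / 22 = j + x / 22 := by omega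
  have e2 : (22 * j + x) % 22 = x % 22 := by omega
  unfold Lf cl
  rw [e1, e2, W_add]

theorem cs_congr {h h' : ℕ → Bool} {L x : ℕ} (hx : x < 22 * L) (hh : ∀ t < L, h t = h' t) :
    cs h x = cs h' x := by
  unfold cs
  rw [hh _ (by omega), wk_congr]
  intro t ht
  exact hh _ (by omega)

theorem cl_congr {h h' : ℕ → Bool} {L x : ℕ} (hx : x < 22 * L) (hh : ∀ t < L, h t = h' t) :
    cl h x = cl h' x := by
  unfold cl
  rw [hh _ (by omega), wk_congr]
  intro t ht
  exact hh _ (by omega)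

theorem exists_ctx (f : ℕ → Bool) (L : ℕ) : ∃ m < 2 ^ L, ∀ t < L, f t = Nat.testBit m t := by
  refine ⟨Nat.ofBits (fun t : Fin L => f t), Nat.ofBits_lt_two_pow _, fun t ht => ?_⟩
  rw [Nat.testBit_ofBits_lt _ _ ht]

theorem nobad_ctx (L lo n : ℕ) (hc : checkL L lo n = true) (i p : ℕ) (h1 : lo < p)
    (h2 : p ≤ lo + n) (hL : 22 + p + p / 3 ≤ 22 * L) :
    ¬ Bad (fun k => S (i + k)) (fun k => Lf (i + k)) p := by
  intro hb
  obtain ⟨m, hm, hctx⟩ := exists_ctx (fun t => code (i / 22 + t)) L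
  have c1 := allB_spec _ _ (force_spec (allB_spec _ _ hc m hm)) (p - lo - 1) (by omega)
  have c2 := allB_spec _ _ c1 (i % 22) (by omega)
  have ep : lo + (p - lo - 1) + 1 = p := by omega
  rw [ep] at c2
  have hS : ∀ a ≤ p + p / 3, S (i + a) =
      W (i / 22) (dg (pack (cs (Nat.testBit m)) (22 * L)) (i % 22 + a)) := by
    intro a ha
    have e : i + a = 22 * (i / 22) + (i % 22 + a) := by omega
    rw [dg_pack _ _ (fun k => cs_lt _ k) _ (by omega), e, S_cs,
      cs_congr (L := L) (by omega) hctx]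
  have hLf : ∀ a ≤ p + p / 3, Lf (i + a) =
      W (i / 22) (dg (pack (cl (Nat.testBit m)) (22 * L)) (i % 22 + a)) := by
    intro a ha
    have e : i + a = 22 * (i / 22) + (i % 22 + a) := by omega
    rw [dg_pack _ _ (fun k => cl_lt _ k) _ (by omega), e, Lf_cl,
      cl_congr (L := L) (by omega) hctx]
  have := badB_of (by omega) (hb.of
    (f' := fun k => dg (pack (cs (Nat.testBit m)) (22 * L)) (i % 22 + k))
    (g' := fun k => dg (pack (cl (Nat.testBit m)) (22 * L)) (i % 22 + k))
    (fun a ha b hb h => by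
      simp only [hS a ha, hS b hb] at h
      exact W_inj _ h)
    (fun a ha b hb h => by
      simp only [hS a ha, hLf b hb] at h
      exact W_inj _ h))
  rw [this] at c2
  cases c2

theorem nobad_small (i p : ℕ) (h1 : 1 ≤ p) (h2 : p ≤ 77) :
    ¬ Bad (fun k => S (i + k)) (fun k => Lf (i + k)) p := by
  by_cases a : p ≤ 16
  · exact nobad_ctx 2 0 16 check2 i p (by omega) (by omega) (by omega)
  by_cases b : p ≤ 33
  · exact nobad_ctx 3 16 17 check3 i p (by omega) (by omega) (by omega)
  by_cases c : p ≤ 49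
  · exact nobad_ctx 4 33 16 check4 i p (by omega) (by omega) (by omega)
  by_cases d : p ≤ 66
  · exact nobad_ctx 5 49 17 check5 i p (by omega) (by omega) (by omega)
  · exact nobad_ctx 6 66 11 check6 i p (by omega) (by omega) (by omega)

/-- signature of a window: equalities at distance 5 -/
def sg (f : ℕ → ℕ) : ℕ → ℕ
  | 0 => 0
  | n + 1 => (if f n = f (n + 5) then 2 ^ n else 0) + sg f n

theorem sg_congr {f g : ℕ → ℕ} (n : ℕ) (h : ∀ k < n, f k = f (k + 5) ↔ g k = g (k + 5)) :
    sg f n = sg g n := by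
  induction n with
  | zero => rfl
  | succ n ih =>
    simp only [sg]
    rw [ih (fun k hk => h k (by omega))]
    simp only [h n (by omega)]

/-- decoding the residue modulo 22 from the signature -/
def dec (s : ℕ) : ℕ :=
  91389729152175674738177603631555517534733477760669001726518499830301003932195698777545456858738054310669376517797118012032678034762676920235015241457756478215168967608684403066398438817794 /
    32 ^ (s % 7148 % 127) % 32

theorem checkSig : ∀ m < 8, ∀ x < 22, dec (sg (fun k => cs (Nat.testBit m) (x + k)) 20) = x := by
  decide +kernel

theorem dec_S (i : ℕ) : dec (sg (fun k => S (i + k)) 20) = i % 22 := by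
  obtain ⟨m, hm, hctx⟩ := exists_ctx (fun t => code (i / 22 + t)) 3
  have key : ∀ a < 25, S (i + a) = W (i / 22) (cs (Nat.testBit m) (i % 22 + a)) := by
    intro a ha
    have e : i + a = 22 * (i / 22) + (i % 22 + a) := by omega
    rw [e, S_cs, cs_congr (L := 3) (by omega) hctx]
  have e : sg (fun k => S (i + k)) 20 = sg (fun k => cs (Nat.testBit m) (i % 22 + k)) 20 := by
    apply sg_congr
    intro k hk
    rw [key k (by omega), key (k + 5) (by omega)]
    exact ⟨fun h => W_inj _ h, fun h => by rw [h]⟩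
  rw [e]
  exact checkSig m hm (i % 22) (by omega)

theorem Bs_pre : ∀ b, dg (Bs b) 0 = 1 ∧ dg (Bs b) 1 = 0 ∧ dg (Bs b) 2 = 2 ∧ dg (Bs b) 3 = 3 := by
  decide +kernel

theorem S_pre (j t : ℕ) (h : t < 22) : S (22 * j + t) = W j (dg (Bs (code j)) t) := by
  unfold S
  have e1 : (22 * j + t) / 22 = j := by omega
  have e2 : (22 * j + t) % 22 = t := by omega
  rw [e1, e2]

theorem W_eq_of {a b : ℕ} (h : ∀ t < 4, S (22 * a + t) = S (22 * b + t)) (x : ℕ) :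
    W a x = W b x := by
  have h0 := h 0 (by omega)
  have h1 := h 1 (by omega)
  have h2 := h 2 (by omega)
  have h3 := h 3 (by omega)
  obtain ⟨a0, a1, a2, a3⟩ := Bs_pre (code a)
  obtain ⟨b0, b1, b2, b3⟩ := Bs_pre (code b)
  rw [S_pre _ _ (by omega), S_pre _ _ (by omega)] at h0 h1 h2 h3
  rw [a0, b0] at h0
  rw [a1, b1] at h1
  rw [a2, b2] at h2
  rw [a3, b3] at h3
  by_cases hx : 5 ≤ x
  · unfold W
    rw [wk_ge _ _ hx, wk_ge _ _ hx]
  have lt : ∀ n y, y < 5 → W n y < 5 := fun n y hy => wk_lt _ _ hy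
  have ne : ∀ n y z, y ≠ z → W n y ≠ W n z := fun n y z hyz h => hyz (W_inj _ h)
  have key : W a 4 = W b 4 := by
    have l0 := lt a 0 (by omega)
    have l1 := lt a 1 (by omega)
    have l2 := lt a 2 (by omega)
    have l3 := lt a 3 (by omega)
    have l4 := lt a 4 (by omega)
    have m4 := lt b 4 (by omega)
    have n01 := ne a 0 1 (by omega)
    have n02 := ne a 0 2 (by omega)
    have n03 := ne a 0 3 (by omega)
    have n12 := ne a 1 2 (by omega)
    have n13 := ne a 1 3 (by omega)
    have n23 := ne a 2 3 (by omega)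
    have k0 := ne a 0 4 (by omega)
    have k1 := ne a 1 4 (by omega)
    have k2 := ne a 2 4 (by omega)
    have k3 := ne a 3 4 (by omega)
    have j0 := ne b 0 4 (by omega)
    have j1 := ne b 1 4 (by omega)
    have j2 := ne b 2 4 (by omega)
    have j3 := ne b 3 4 (by omega)
    rw [← h0] at j1
    rw [← h1] at j0
    rw [← h2] at j2
    rw [← h3] at j3
    generalize W a 0 = p0 at *
    generalize W a 1 = p1 at *
    generalize W a 2 = p2 at *
    generalize W a 3 = p3 at *
    generalize W a 4 = p4 at *
    generalize W b 4 = q4 at *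
    clear h h0 h1 h2 h3 a0 a1 a2 a3 b0 b1 b2 b3 lt ne
    interval_cases p0 <;> interval_cases p1 <;> omega
  have hx' : x < 5 := by omega
  interval_cases x <;> assumption

theorem nobad (i p : ℕ) (hp : 1 ≤ p) : ¬ Bad (fun k => S (i + k)) (fun k => Lf (i + k)) p := by
  by_cases h77 : p ≤ 77
  · exact nobad_small i p hp h77
  intro hb
  have hr : ∀ k < p / 3 - 1, S (i + k) = S (i + (p + k)) := hb.run
  have hmod : i % 22 = (i + p) % 22 := by
    have e : sg (fun k => S (i + k)) 20 = sg (fun k => S (i + p + k)) 20 := by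
      apply sg_congr
      intro k hk
      rw [hr k (by omega), hr (k + 5) (by omega)]
      simp only [add_assoc]
    rw [← dec_S, ← dec_S, e]
  obtain ⟨p', rfl⟩ : ∃ p', p = 22 * p' := ⟨p / 22, by omega⟩
  refine W_lemma p' ((i + 21) / 22) (by omega) ?_
  intro k hk x
  apply W_eq_of
  intro t ht
  have hlt : 22 * ((i + 21) / 22 + k) + t - i < 22 * p' / 3 - 1 := by
    have : 22 * ((i + 21) / 22 + k) + t - i ≤ 24 + 22 * k := by omega
    omega
  have h3 := hr _ hlt
  have e1 : i + (22 * ((i + 21) / 22 + k) + t - i) = 22 * ((i + 21) / 22 + k) + t := by omega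
  have e2 : i + (22 * p' + (22 * ((i + 21) / 22 + k) + t - i)) =
      22 * ((i + 21) / 22 + p' + k) + t := by omega
  rwa [e1, e2] at h3

end Cat
namespace Cat

theorem exists_Z : ∃ zs zl : ℤ → Fin 5, ∀ (i : ℤ) (p : ℕ), 1 ≤ p →
    ¬ Bad (fun k : ℕ => zs (i + k)) (fun k : ℕ => zl (i + k)) p := by
  let F : ℕ → Fin 5 × Fin 5 := fun n => (⟨S n, S_lt n⟩, ⟨Lf n, Lf_lt n⟩)
  have ex : ∀ i : ℤ, ∃ a : Fin 5 × Fin 5,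
      ∀ᶠ n : ℕ in (Filter.hyperfilter ℕ : Filter ℕ), F ((n : ℤ) + i).toNat = a := by
    intro i
    obtain ⟨a, ha⟩ := Ultrafilter.eq_pure_of_finite
      ((Filter.hyperfilter ℕ).map (fun n : ℕ => F ((n : ℤ) + i).toNat))
    refine ⟨a, ?_⟩
    have h1 : ({a} : Set (Fin 5 × Fin 5)) ∈
        (Filter.hyperfilter ℕ).map (fun n : ℕ => F ((n : ℤ) + i).toNat) := by
      rw [ha]
      exact Ultrafilter.mem_pure.2 rfl
    exact h1
  choose z hz using ex
  refine ⟨fun i => (z i).1, fun i => (z i).2, fun i p hp hb => ?_⟩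
  have hall : ∀ᶠ n : ℕ in (Filter.hyperfilter ℕ : Filter ℕ), ∀ k ∈ Set.Iic (p + p / 3),
      F ((n : ℤ) + (i + (k : ℕ))).toNat = z (i + (k : ℕ)) :=
    (Filter.eventually_all_finite (Set.finite_Iic _)).2 (fun k _ => hz _)
  have hge : ∀ᶠ n : ℕ in (Filter.hyperfilter ℕ : Filter ℕ), i.natAbs ≤ n :=
    Filter.Eventually.filter_mono Nat.hyperfilter_le_atTop (Filter.eventually_ge_atTop _)
  obtain ⟨n, hn, hge⟩ := (hall.and hge).exists
  have key : ∀ k ≤ p + p / 3, z (i + (k : ℕ)) = F (((n : ℤ) + i).toNat + k) := by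
    intro k hk
    rw [← hn k hk]
    congr 1
    omega
  refine nobad ((n : ℤ) + i).toNat p hp (hb.of ?_ ?_)
  · intro a ha b hb h
    simp only [key a ha, key b hb] at h
    exact congrArg Fin.val h
  · intro a ha b hb h
    simp only [key a ha, key b hb] at h
    exact congrArg Fin.val h

theorem adj_iff (a b : ℤ × Bool) : InfCaterpillar.Adj a b ↔
    (a.2 = false ∧ b.2 = false ∧ (b.1 = a.1 + 1 ∨ b.1 = a.1 - 1)) ∨ (a.2 ≠ b.2 ∧ b.1 = a.1) := by
  obtain ⟨x, l⟩ := a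
  obtain ⟨y, m⟩ := b
  simp only [InfCaterpillar, SimpleGraph.fromRel_adj, ne_eq, Prod.mk.injEq]
  cases l <;> cases m <;> simp <;> omega

def col (zs zl : ℤ → Fin 5) (a : ℤ × Bool) : Fin 5 := if a.2 then zl a.1 else zs a.1

theorem core (zs zl : ℤ → Fin 5)
    (hz : ∀ (i : ℤ) (p : ℕ), 1 ≤ p → ¬ Bad (fun k : ℕ => zs (i + k)) (fun k : ℕ => zl (i + k)) p)
    (P : ℕ) (hP : 3 ≤ P) (v : ℕ → ℤ × Bool) (a : ℤ)
    (hmid : ∀ k : ℕ, 1 ≤ k → k < P + P / 3 → v k = (a + k - 1, false))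
    (h0 : v 0 = (a - 1, false) ∨ v 0 = (a, true))
    (hN : v (P + P / 3) = (a + (P + P / 3 : ℕ) - 1, false) ∨
      v (P + P / 3) = (a + (P + P / 3 : ℕ) - 2, true))
    (hc : ∀ k ≤ P / 3, col zs zl (v k) = col zs zl (v (P + k))) : False := by
  have mid : ∀ k : ℕ, 1 ≤ k → k < P + P / 3 → col zs zl (v k) = zs (a + k - 1) := by
    intro k h1 h2
    rw [hmid k h1 h2]
    rfl
  have c0 := hc 0 (by omega)
  have cN := hc (P / 3) le_rfl
  rw [add_zero, mid P (by omega) (by omega)] at c0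
  rw [mid (P / 3) (by omega) (by omega)] at cN
  have cm : ∀ k, 1 ≤ k → k < P / 3 → zs (a + k - 1) = zs (a + (P + k : ℕ) - 1) := by
    intro k h1 h2
    rw [← mid k h1 (by omega), ← mid (P + k) (by omega) (by omega)]
    exact hc k (by omega)
  rcases h0 with h0 | h0 <;> rcases hN with hN | hN <;> rw [h0] at c0 <;> rw [hN] at cN <;>
    simp only [col, if_true, if_false, Bool.false_eq_true] at c0 cN
  · refine hz (a - 1) P (by omega) (Or.inl fun k hk => ?_)
    rcases Nat.eq_zero_or_pos k with rfl | hk0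
    · convert c0 using 2 <;> push_cast <;> ring
    · by_cases hk' : k = P / 3
      · subst hk'
        convert cN using 2 <;> push_cast <;> ring
      · convert cm k hk0 (by omega) using 2 <;> push_cast <;> ring
  · refine hz (a - 1) P (by omega) (Or.inr (Or.inr (Or.inl ⟨fun k hk => ?_, ?_⟩)))
    · rcases Nat.eq_zero_or_pos k with rfl | hk0
      · convert c0 using 2 <;> push_cast <;> ring
      · convert cm k hk0 (by omega) using 2 <;> push_cast <;> ring
    · convert cN using 2 <;> omega
  · refine hz a P (by omega) (Or.inr (Or.inl ⟨?_, fun k hk => ?_⟩))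
    · convert c0 using 2 <;> omega
    · by_cases hk' : k + 1 = P / 3
      · rw [← hk'] at cN
        convert cN using 2 <;> push_cast <;> ring
      · convert cm (k + 1) (by omega) (by omega) using 2 <;> push_cast <;> ring
  · refine hz a P (by omega) (Or.inr (Or.inr (Or.inr ⟨by omega, ?_, fun k hk => ?_, ?_⟩)))
    · convert c0 using 2 <;> omega
    · convert cm (k + 1) (by omega) (by omega) using 2 <;> push_cast <;> ring
    · convert cN using 2 <;> omega

theorem mid_spine {a b c : ℤ × Bool} (h1 : InfCaterpillar.Adj a b) (h2 : InfCaterpillar.Adj b c)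
    (h : a ≠ c) : b.2 = false := by
  rw [adj_iff] at h1 h2
  obtain ⟨x, l⟩ := a
  obtain ⟨y, m⟩ := b
  obtain ⟨z, n⟩ := c
  cases l <;> cases m <;> cases n <;> simp_all

theorem endp {a d : ℤ} {w : ℤ × Bool} (hd : d = 1 ∨ d = -1) (h1 : InfCaterpillar.Adj (a, false) w)
    (h2 : w ≠ (a + d, false)) : w = (a - d, false) ∨ w = (a, true) := by
  rw [adj_iff] at h1
  obtain ⟨x, l⟩ := w
  cases l
  · left
    simp only [Prod.mk.injEq, and_true, ne_eq, not_true_eq_false, false_and, or_false,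
      true_and] at *
    omega
  · right
    simpa using h1

theorem path_core (zs zl : ℤ → Fin 5)
    (hz : ∀ (i : ℤ) (p : ℕ), 1 ≤ p → ¬ Bad (fun k : ℕ => zs (i + k)) (fun k : ℕ => zl (i + k)) p)
    (P : ℕ) (hP : 1 ≤ P) (v : ℕ → ℤ × Bool)
    (hadj : ∀ k < P + P / 3, InfCaterpillar.Adj (v k) (v (k + 1)))
    (hne : ∀ k, k + 2 ≤ P + P / 3 → v k ≠ v (k + 2))
    (hc : ∀ k ≤ P / 3, col zs zl (v k) = col zs zl (v (P + k))) : False := by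
  have hsp : ∀ k, k + 2 ≤ P + P / 3 → (v (k + 1)).2 = false := fun k hk =>
    mid_spine (hadj k (by omega)) (hadj (k + 1) (by omega)) (hne k hk)
  by_cases hP3 : 3 ≤ P
  · obtain ⟨a, ha⟩ : ∃ a, v 1 = (a, false) := ⟨(v 1).1, Prod.ext rfl (hsp 0 (by omega))⟩
    obtain ⟨d, hd, hv2⟩ : ∃ d : ℤ, (d = 1 ∨ d = -1) ∧ v 2 = (a + d, false) := by
      have h1 := hadj 1 (by omega)
      have h2 := hsp 1 (by omega)
      rw [adj_iff, ha] at h1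
      change (v 2).2 = false at h2
      rcases h1 with ⟨-, -, h | h⟩ | ⟨h, -⟩
      · exact ⟨1, Or.inl rfl, Prod.ext h h2⟩
      · exact ⟨-1, Or.inr rfl, Prod.ext h h2⟩
      · exact absurd h2.symm h
    have lin : ∀ k : ℕ, k + 2 < P + P / 3 →
        v (k + 1) = (a + k * d, false) ∧ v (k + 2) = (a + (k + 1) * d, false) := by
      intro k
      induction k with
      | zero => intro _; exact ⟨by rw [ha]; simp, by rw [hv2]; simp⟩
      | succ k ih =>
        intro hk
        obtain ⟨i1, i2⟩ := ih (by omega)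
        have h1 := hadj (k + 2) (by omega)
        have h2 := hne (k + 1) (by omega)
        have h3 := hsp (k + 2) (by omega)
        rw [i1] at h2
        rw [i2] at h1
        refine ⟨by rw [i2]; push_cast; rfl, ?_⟩
        have h4 := endp (d := -d) (by omega) h1 (by
          intro h
          apply h2
          show _ = v (k + 2 + 1)
          rw [h]
          congr 1
          ring)
        show v (k + 2 + 1) = _
        rcases h4 with h4 | h4
        · rw [h4]
          congr 1
          push_cast
          ring
        · rw [h4] at h3
          cases h3
    have lin' : ∀ k : ℕ, 1 ≤ k → k < P + P / 3 → v k = (a + (k - 1) * d, false) := by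
      intro k h1 h2
      obtain ⟨k, rfl⟩ := Nat.exists_eq_add_of_le' h1
      rcases k with _ | k
      · rw [ha]; simp
      · rw [(lin k (by omega)).2]; push_cast; congr 1; ring
    have e0 : v 0 = (a - d, false) ∨ v 0 = (a, true) := by
      apply endp hd
      · rw [← ha]; exact (hadj 0 (by omega)).symm
      · rw [← hv2]; exact hne 0 (by omega)
    have eN : v (P + P / 3) = (a + ((P + P / 3 : ℕ) - 1) * d, false) ∨
        v (P + P / 3) = (a + ((P + P / 3 : ℕ) - 2) * d, true) := by
      have h1 := hadj (P + P / 3 - 1) (by omega)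
      have h2 := hne (P + P / 3 - 2) (by omega)
      have q1 : P + P / 3 - 1 + 1 = P + P / 3 := by omega
      have q2 : P + P / 3 - 2 + 2 = P + P / 3 := by omega
      rw [q1, lin' _ (by omega) (by omega)] at h1
      rw [q2, lin' _ (by omega) (by omega)] at h2
      have c1 : ((P + P / 3 - 1 : ℕ) : ℤ) = (P + P / 3 : ℕ) - 1 := by omega
      have c2 : ((P + P / 3 - 2 : ℕ) : ℤ) = (P + P / 3 : ℕ) - 2 := by omega
      rw [c1] at h1
      rw [c2] at h2
      rcases endp (d := -d) (by omega) h1 (by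
        intro h
        apply h2
        rw [h]
        congr 1
        ring) with h | h
      · left
        rw [h]
        congr 1
        ring
      · right
        rw [h]
        congr 1
        ring
    rcases hd with rfl | rfl
    · refine core zs zl hz P hP3 v a ?_ e0 ?_ hc
      · intro k h1 h2
        rw [lin' k h1 h2]
        congr 1
        ring
      · rcases eN with h | h
        · exact Or.inl (h.trans (by congr 1; ring))
        · exact Or.inr (h.trans (by congr 1; ring))
    · refine core zs zl hz P hP3 (fun k => v (P + P / 3 - k)) (a - (P + P / 3 : ℕ) + 2) ?_ ?_ ?_ ?_
      · intro k h1 h2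
        show v (P + P / 3 - k) = _
        rw [lin' _ (by omega) (by omega)]
        congr 1
        omega
      · show v (P + P / 3) = _ ∨ v (P + P / 3) = _
        rcases eN with h | h
        · exact Or.inl (h.trans (by congr 1; ring))
        · exact Or.inr (h.trans (by congr 1; ring))
      · show v (P + P / 3 - (P + P / 3)) = _ ∨ v (P + P / 3 - (P + P / 3)) = _
        rw [Nat.sub_self]
        rcases e0 with h | h
        · exact Or.inl (h.trans (by congr 1; ring))
        · exact Or.inr (h.trans (by congr 1; ring))
      · intro k hk
        have := hc (P / 3 - k) (by omega)
        have q1 : P + (P / 3 - k) = P + P / 3 - k := by omega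
        have q2 : P + P / 3 - (P + k) = P / 3 - k := by omega
        show col zs zl (v (P + P / 3 - k)) = col zs zl (v (P + P / 3 - (P + k)))
        rw [q2, this, q1]
  · have c0 := hc 0 (by omega)
    rw [add_zero] at c0
    have A : ∀ (i : ℤ) (p : ℕ), 1 ≤ p → p < 3 → zs i ≠ zs (i + p) := by
      intro i p h1 h2 h
      refine hz i p h1 (Or.inl fun k hk => ?_)
      obtain rfl : k = 0 := by omega
      simpa using h
    have B : ∀ (i : ℤ) (p : ℕ), 1 ≤ p → p < 3 → zl i ≠ zs (i + (p - 1 : ℕ)) := by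
      intro i p h1 h2 h
      refine hz i p h1 (Or.inr (Or.inl ⟨by simpa using h, fun k hk => ?_⟩))
      omega
    have C : ∀ (i : ℤ) (p : ℕ), 1 ≤ p → p < 3 → zs i ≠ zl (i + (p - 1 : ℕ)) := by
      intro i p h1 h2 h
      refine hz i p h1 (Or.inr (Or.inr (Or.inl ⟨fun k hk => ?_, ?_⟩)))
      · omega
      · have e : p / 3 = 0 := by omega
        simpa [e] using h
    have h0 := hadj 0 (by omega)
    obtain rfl | rfl : P = 1 ∨ P = 2 := by omega
    · change InfCaterpillar.Adj (v 0) (v 1) at h0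
      rw [adj_iff] at h0
      generalize v 0 = s at *
      generalize v 1 = t at *
      obtain ⟨x, l⟩ := s
      obtain ⟨y, m⟩ := t
      have a1 := A x 1 le_rfl (by omega)
      have a2 := A y 1 le_rfl (by omega)
      have b1 := B x 1 le_rfl (by omega)
      cases l <;> cases m <;> simp [col] at * <;> grind
    · have h1 := hadj 1 (by omega)
      have h2 := hne 0 (by omega)
      have h3 := hsp 0 (by omega)
      simp only [zero_add, one_add_one_eq_two] at h0 h1 h2 h3
      rw [adj_iff] at h0 h1
      generalize v 0 = s at *
      generalize v 1 = t at *
      generalize v 2 = u at *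
      obtain ⟨x, l⟩ := s
      obtain ⟨y, m⟩ := t
      obtain ⟨w, n⟩ := u
      have a1 := A (y - 1) 2 (by omega) (by omega)
      have b1 := B y 2 (by omega) (by omega)
      have c1 := C (y - 1) 2 (by omega) (by omega)
      have e1 : y - 1 + ((2 : ℕ) : ℤ) = y + 1 := by push_cast; ring
      have e2 : y + ((2 - 1 : ℕ) : ℤ) = y + 1 := by push_cast; ring
      have e3 : y - 1 + ((2 - 1 : ℕ) : ℤ) = y := by push_cast; ring
      rw [e1] at a1
      rw [e2] at b1
      rw [e3] at c1
      clear A B C hadj hne hsp hz hc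
      cases l <;> cases m <;> cases n <;> simp [col] at * <;> grind

end Cat

/-- The infinite caterpillar of maximum degree 3 admits a 5-coloring that is (4/3)⁺-free. -/
theorem infCaterpillar_five_coloring_free :
    ∃ c : ℤ × Bool → Fin 5, ColoringFreePlus InfCaterpillar c (4 / 3) := by
  obtain ⟨zs, zl, hz⟩ := Cat.exists_Z
  refine ⟨Cat.col zs zl, ?_⟩
  intro a b w hw hrep
  obtain ⟨p, e, hp, ⟨s, t, hst⟩, ⟨r, her⟩, hgt⟩ := hrep
  have hp1 : 1 ≤ p.length := List.length_pos_iff.2 hp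
  have hlen : p.length < 3 * e.length := by
    have hpos : (0 : ℝ) < p.length := by exact_mod_cast hp1
    rw [lt_div_iff₀ hpos] at hgt
    have : (p.length : ℝ) < 3 * e.length := by linarith
    exact_mod_cast this
  have hL : s.length + (p.length + e.length) + t.length = w.length + 1 := by
    have := congrArg List.length hst
    simp only [List.length_append, List.length_map, Walk.length_support] at this
    omega
  have get : ∀ k < p.length + e.length,
      some (Cat.col zs zl (w.getVert (s.length + k))) = (p ++ e)[k]? := by
    intro k hk
    have h1 : (w.support.map (Cat.col zs zl))[s.length + k]? = (p ++ e)[k]? := by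
      rw [← hst, List.append_assoc, List.getElem?_append_right (by omega)]
      rw [List.getElem?_append_left (by simp; omega)]
      congr 1
      omega
    rw [← h1, List.getElem?_map, ← Walk.getVert_eq_support_getElem? w (by omega)]
    rfl
  refine Cat.path_core zs zl hz p.length hp1 (fun k => w.getVert (s.length + k)) ?_ ?_ ?_
  · intro k hk
    exact w.adj_getVert_succ (by omega)
  · intro k hk h
    have := hw.getVert_injOn (show s.length + k ≤ w.length by omega)
      (show s.length + (k + 2) ≤ w.length by omega) h
    omega
  · intro k hk
    have h1 := get k (by omega)
    have h2 := get (p.length + k) (by omega)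
    rw [List.getElem?_append_right (by omega), Nat.add_sub_cancel_left] at h2
    rw [← her, List.getElem?_append_left (by omega), ← h2] at h1
    exact Option.some.inj h1
end
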